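/- arXiv:2002.04713 — 2 statements merged into one kernel-verified Lean document; each statement's English description precedes it below -/
import Mathlib

section
/- Let X ⊂ ℙ^n be a smooth complete intersection of s = n − 2 hypersurfaces of degrees d_1, …, d_s ≥ 2 with d_1 + ⋯ + d_s = n (so X is a surface). Then X contains only finitely many projective lines. -/
/-! Formalization of: a smooth complete intersection surface X ⊆ ℙ^n of s = n − 2
hypersurfaces of degrees d_1,…,d_s ≥ 2 with Σ d_i = n contains only finitely many
projective lines. -/

noncomputable section

/-- The Zariski topology on complex projective `n`-space `ℙ(ℂ^{n+1})`: it is generated by the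
complements of the zero loci of homogeneous polynomials. -/
instance projZariski (n : ℕ) : TopologicalSpace (Projectivization ℂ (Fin (n + 1) → ℂ)) :=
  TopologicalSpace.generateFrom
    {U | ∃ (k : ℕ) (f : MvPolynomial (Fin (n + 1)) ℂ), f.IsHomogeneous k ∧
      U = {x | MvPolynomial.eval x.rep f ≠ 0}}

/-- The Grassmannian `G(1,n)` of projective lines in `ℙ^n`, i.e. the set of 2-dimensional
linear subspaces of `ℂ^{n+1}`. -/
def ProjLine (n : ℕ) : Type :=
  {W : Submodule ℂ (Fin (n + 1) → ℂ) // Module.finrank ℂ W = 2}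

/-- The Zariski topology on the Grassmannian of lines: it is generated by the complements of
the loci of lines `ℙ(W)` on which a fixed polynomial in two vector arguments vanishes
identically on `W × W` (e.g. polynomials in the Plücker coordinates). -/
instance grassZariski (n : ℕ) : TopologicalSpace (ProjLine n) :=
  TopologicalSpace.generateFrom
    {U | ∃ F : MvPolynomial (Fin (n + 1) ⊕ Fin (n + 1)) ℂ,
      U = {W : ProjLine n | ¬ ∀ u ∈ W.1, ∀ v ∈ W.1, MvPolynomial.eval (Sum.elim u v) F = 0}}

/-- The projective line `ℙ(W) ⊆ ℙ^n` associated to a linear subspace `W ⊆ ℂ^{n+1}`,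
as a set of points of `ℙ^n`. -/
def lineSet {n : ℕ} (W : Submodule ℂ (Fin (n + 1) → ℂ)) :
    Set (Projectivization ℂ (Fin (n + 1) → ℂ)) :=
  {x | x.rep ∈ W}

/-- The Fano variety of lines of `X ⊆ ℙ^n`: the subset of the Grassmannian of lines
consisting of the lines contained in `X`. -/
def fanoLines {n : ℕ} (X : Set (Projectivization ℂ (Fin (n + 1) → ℂ))) : Set (ProjLine n) :=
  {W | lineSet W.1 ⊆ X}

/-- `X ⊆ ℙ^n` is a smooth complete intersection of the `s` hypersurfaces of degrees
`d 0, …, d (s-1)` cut out by the homogeneous polynomials `f 0, …, f (s-1)`:  each `f i` is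
homogeneous of degree `d i ≥ 2`, `X` is the common zero locus of the `f i`, `X` has
codimension `s` (i.e. dimension `n - s`), and the Jacobian matrix `(∂f_i/∂x_j)` has rank `s`
at every point of (the affine cone over) `X`. -/
structure IsSmoothCI (n s : ℕ) (d : Fin s → ℕ) (f : Fin s → MvPolynomial (Fin (n + 1)) ℂ)
    (X : Set (Projectivization ℂ (Fin (n + 1) → ℂ))) : Prop where
  two_le_deg : ∀ i, 2 ≤ d i
  homog : ∀ i, (f i).IsHomogeneous (d i)
  locus : X = {x | ∀ i, MvPolynomial.eval x.rep (f i) = 0}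
  codim : topologicalKrullDim ↥X = ((n - s : ℕ) : WithBot ℕ∞)
  smooth : ∀ v : Fin (n + 1) → ℂ, v ≠ 0 → (∀ i, MvPolynomial.eval v (f i) = 0) →
    (Matrix.of fun i j => MvPolynomial.eval v (MvPolynomial.pderiv j (f i))).rank = s

section Helpers

open MvPolynomial


theorem dual_eval {σ : Type*} [Fintype σ] (F : MvPolynomial σ ℂ) (x p : σ → ℂ) :
    aeval (fun l => (TrivSqZeroExt.inl (x l) + TrivSqZeroExt.inr (p l) : DualNumber ℂ)) F
      = TrivSqZeroExt.inl (eval x F) + TrivSqZeroExt.inr (∑ l, eval x (pderiv l F) * p l) := by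
  classical
  induction F using MvPolynomial.induction_on with
  | C a => simp; rfl
  | add f g hf hg => 
    rw [map_add, hf, hg]; ext <;> simp [add_mul, Finset.sum_add_distrib]
  | mul_X f i hf =>
    rw [map_mul, hf, aeval_X]; ext 
    · simp
    · simp [add_mul, Finset.sum_add_distrib, pderiv_X, Pi.single_apply, apply_ite, ite_mul, Finset.sum_mul]
      apply Finset.sum_congr rfl; intros; ring

theorem taylor {σ : Type*} [Fintype σ] (x : σ → ℂ) (F : MvPolynomial σ ℂ) (M : Ideal (MvPolynomial σ ℂ)) 
    (hM : ∀ l, X l - C (x l) ∈ M) :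
    F - C (eval x F) ∈ M ∧ F - C (eval x F) - ∑ l, C (eval x (pderiv l F)) * (X l - C (x l)) ∈ M * M := by
  classical
  induction F using MvPolynomial.induction_on with
  | C a => simp
  | add f g hf hg => 
    constructor
    · convert M.add_mem hf.1 hg.1 using 1; simp; ring
    · convert (M * M).add_mem hf.2 hg.2 using 1; simp [add_mul, Finset.sum_add_distrib]; ring
  | mul_X f i hf =>
    constructor
    · convert M.add_mem (M.mul_mem_left (X i) hf.1) (M.mul_mem_left (C (eval x f)) (hM i)) using 1; simp; ring
    · convert (M*M).add_mem ((M*M).mul_mem_left (C (x i)) hf.2) (Ideal.mul_mem_mul hf.1 (hM i)) using 1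
      have : ∑ l, C (eval x (pderiv l (f * X i))) * (X l - C (x l)) = 
        C (x i) * ∑ l, C (eval x (pderiv l f)) * (X l - C (x l)) + C (eval x f) * (X i - C (x i)) := by
        simp [add_mul, Finset.sum_add_distrib, pderiv_X, Pi.single_apply, apply_ite, ite_mul, Finset.mul_sum]
        rw [add_comm]; congr 1; apply Finset.sum_congr rfl; intros; ring
      rw [this]; simp; ring

theorem finite_zero {σ : Type*} [Fintype σ] (S : Set (MvPolynomial σ ℂ)) 
    (h : ∀ x : σ → ℂ, (∀ F ∈ S, eval x F = 0) → ∀ p : σ → ℂ, 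
      (∀ F ∈ S, aeval (fun l => (TrivSqZeroExt.inl (x l) + TrivSqZeroExt.inr (p l) : DualNumber ℂ)) F = 0) → p = 0) :
    {x : σ → ℂ | ∀ F ∈ S, eval x F = 0}.Finite := by
  classical
  set I := Ideal.span S
  let m : (σ → ℂ) → Ideal (MvPolynomial σ ℂ) := fun x => RingHom.ker (eval x)
  have hX : ∀ x l, X l - C (x l) ∈ m x := by intro x l; simp [m, RingHom.mem_ker]
  have hinj : Function.Injective m := by
    intro x y hxy
    ext l
    have := hX x l
    rw [hxy] at this
    simp [m, RingHom.mem_ker] at this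
    exact (sub_eq_zero.1 this).symm
  refine Set.Finite.of_finite_image (f := m) ?_ hinj.injOn
  refine (Ideal.finite_minimalPrimes_of_isNoetherianRing _ I).subset ?_
  rintro _ ⟨x, hx, rfl⟩
  have hIm : I ≤ m x := Ideal.span_le.2 fun F hF => hx F hF
  have hpr : (m x).IsPrime := RingHom.ker_isPrime _
  let T : (σ → ℂ) →ₗ[ℂ] MvPolynomial σ ℂ := 
    { toFun := fun c => ∑ l, C (c l) * (X l - C (x l))
      map_add' := by intro a b; simp [add_mul, Finset.sum_add_distrib]
      map_smul' := by intro a b; simp [Finset.smul_sum, smul_eq_C_mul, mul_assoc] }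
  let U : Submodule ℂ (σ → ℂ) := ((I ⊔ m x * m x).restrictScalars ℂ).comap T
  have hU : U = ⊤ := by
    by_contra hne
    obtain ⟨g, hg0, hg⟩ := Submodule.exists_le_ker_of_lt_top U (lt_top_iff_ne_top.2 hne)
    have hgs : ∀ c, g c = ∑ l, c l * g (Pi.single l 1) := by
      intro c
      conv_lhs => rw [← LinearMap.sum_single_apply (fun _ => ℂ) c]
      rw [map_sum]
      apply Finset.sum_congr rfl
      intro l _
      rw [← smul_eq_mul, ← map_smul]
      congr 1
      ext k; simp [Pi.single_apply]
    have := h x hx (fun l => g (Pi.single l 1)) (by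
      intro F hF
      rw [dual_eval, hx F hF, ← hgs]
      have : (fun l => eval x (pderiv l F)) ∈ U := by
        change T _ ∈ I ⊔ m x * m x
        have h1 := (taylor x F (m x) (hX x)).2
        rw [hx F hF] at h1
        have h2 : F ∈ I := Ideal.subset_span hF
        have := Ideal.sub_mem _ (Ideal.mem_sup_left (T := m x * m x) h2) (Ideal.mem_sup_right (S := I) h1)
        convert this using 1
        simp [T]
      have := hg this
      rw [LinearMap.mem_ker] at this
      rw [this]; simp)
    apply hg0
    ext l
    simpa using congrFun this l
  have hle : m x ≤ I ⊔ m x • m x := by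
    intro F hF
    have hF : eval x F = 0 := hF
    have h1 := (taylor x F (m x) (hX x)).2
    rw [hF] at h1
    have h2 : (fun l => eval x (pderiv l F)) ∈ U := hU ▸ Submodule.mem_top
    have h2 : T _ ∈ I ⊔ m x * m x := h2
    have := Ideal.add_mem _ h2 (Ideal.mem_sup_right (S := I) h1)
    have h3 : F = T (fun l => eval x (pderiv l F)) + (F - C 0 - ∑ l, C (eval x (pderiv l F)) * (X l - C (x l))) := by
      change F = (∑ l, C (eval x (pderiv l F)) * (X l - C (x l))) + _
      simp
    rw [h3]
    exact this
  refine ⟨⟨hpr, hIm⟩, ?_⟩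
  rintro P ⟨hP, hIP⟩ hPm
  obtain ⟨r, hr, hr2⟩ := Submodule.exists_sub_one_mem_and_smul_le_of_fg_of_le_sup (I := m x) (N' := m x) (N := P) 
    (P := m x) (IsNoetherian.noetherian _) le_rfl (hle.trans (sup_le_sup_right hIP _))
  intro F hF
  have : r * F ∈ P := hr2 (Submodule.smul_mem_pointwise_smul _ _ _ hF)
  refine (hP.mem_or_mem this).resolve_left fun hrP => hpr.ne_top ?_
  rw [Ideal.eq_top_iff_one]
  simpa using (m x).sub_mem (hPm hrP) hr

theorem line_coeff {σ : Type*} [Fintype σ] (G : MvPolynomial σ ℂ) (N : ℕ) (hG : G.IsHomogeneous N) (u v : σ → ℂ) :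
    (aeval (fun l => Polynomial.C (u l) + Polynomial.X * Polynomial.C (v l)) G).natDegree ≤ N ∧
    (aeval (fun l => Polynomial.C (u l) + Polynomial.X * Polynomial.C (v l)) G).coeff N = eval v G := by
  classical
  set L : σ → Polynomial ℂ := fun l => Polynomial.C (u l) + Polynomial.X * Polynomial.C (v l) with hL
  have hdeg : ∀ l, (L l).natDegree ≤ 1 := by
    intro l; simp only [hL]; compute_degree
  have hc : ∀ l, (L l).coeff 1 = v l := by
    intro l; simp [hL, Polynomial.coeff_C]
  refine ⟨by simpa using MvPolynomial.aeval_natDegree_le G hG.totalDegree_le L hdeg, ?_⟩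
  have hpow : ∀ l k, (L l ^ k).natDegree ≤ k ∧ (L l ^ k).coeff k = v l ^ k := by
    intro l k
    refine ⟨by simpa using Polynomial.natDegree_pow_le_of_le k (hdeg l), ?_⟩
    have := Polynomial.coeff_pow_of_natDegree_le (hdeg l) (m := k)
    simpa [hc] using this
  have hprod : ∀ (e : σ → ℕ) (t : Finset σ), (∏ l ∈ t, L l ^ e l).natDegree ≤ ∑ l ∈ t, e l ∧
      (∏ l ∈ t, L l ^ e l).coeff (∑ l ∈ t, e l) = ∏ l ∈ t, v l ^ e l := by
    intro e t
    induction t using Finset.induction_on with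
    | empty => simp
    | insert a t ha ih =>
      rw [Finset.prod_insert ha, Finset.sum_insert ha, Finset.prod_insert ha]
      refine ⟨Polynomial.natDegree_mul_le_of_le (hpow a _).1 ih.1, ?_⟩
      rw [Polynomial.coeff_mul_add_eq_of_natDegree_le (hpow a _).1 ih.1, (hpow a _).2, ih.2]
  rw [aeval_def, eval₂_eq', eval_eq', Polynomial.finsetSum_coeff]
  apply Finset.sum_congr rfl
  intro e he
  have h1 : ∑ l, e l = N := by
    have := hG (mem_support_iff.1 he)
    rw [← this, Finsupp.weight_apply, Finsupp.sum_fintype] <;> simp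
  rw [Polynomial.algebraMap_eq, Polynomial.coeff_C_mul, ← h1, (hprod e _).2]

section
variable {s : ℕ} {R : Type*} [CommRing R]

/-- Square matrix with rows `g`, `e_i`, `e_j`, `e_m`. -/
def bigMat (g : Fin s → Fin (s + 3) → R) (i j m : Fin (s + 3)) :
    Matrix (Fin s ⊕ Fin 3) (Fin s ⊕ Fin 3) R :=
  Matrix.of fun r c => (Sum.elim g ![Pi.single i 1, Pi.single j 1, Pi.single m 1] r : Fin (s + 3) → R)
    (finSumFinEquiv c)

theorem bigMat_mulVec (g : Fin s → Fin (s + 3) → R) (i j m : Fin (s + 3)) (y : Fin (s + 3) → R) (r) :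
    (bigMat g i j m).mulVec (fun c => y (finSumFinEquiv c)) r =
      Sum.elim (fun k => ∑ l, g k l * y l) ![y i, y j, y m] r := by
  simp only [bigMat, Matrix.mulVec, dotProduct, Matrix.of_apply]
  rw [Equiv.sum_comp finSumFinEquiv (fun l => (Sum.elim g ![Pi.single i 1, Pi.single j 1, Pi.single m 1] r : Fin (s + 3) → R) l * y l)]
  rcases r with k | r
  · rfl
  · fin_cases r <;> simp [Pi.single_apply]

theorem bigMat_cross (g : Fin s → Fin (s + 3) → R) (i j : Fin (s + 3)) (y : Fin (s + 3) → R)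
    (hg : ∀ k, ∑ l, g k l * y l = 0) (hi : y i = 0) (hj : y j = 0) (m k : Fin (s + 3)) :
    y m * (bigMat g i j k).det = y k * (bigMat g i j m).det := by
  classical
  set N := bigMat g i j k with hN
  set y' : Fin s ⊕ Fin 3 → R := fun c => y (finSumFinEquiv c)
  have h1 : N.mulVec y' = Pi.single (Sum.inr 2) (y k) := by
    ext r
    rw [hN, bigMat_mulVec]
    rcases r with a | r
    · simp [hg]
    · fin_cases r <;> simp [hi, hj, Pi.single_apply]
  have h2 : N.adjugate.mulVec (N.mulVec y') = N.det • y' := by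
    rw [Matrix.mulVec_mulVec, Matrix.adjugate_mul, Matrix.smul_mulVec, Matrix.one_mulVec]
  rw [h1] at h2
  have h3 := congrFun h2 (finSumFinEquiv.symm m)
  simp only [Matrix.mulVec_single, Pi.smul_apply, MulOpposite.smul_eq_mul_unop, smul_eq_mul, y', Equiv.apply_symm_apply] at h3
  rw [mul_comm, ← h3]
  simp only [Matrix.col_apply, MulOpposite.unop_op]
  rw [Matrix.adjugate_apply, mul_comm]
  congr 2
  ext r c
  simp only [hN, bigMat, Matrix.updateRow_apply, Matrix.of_apply]
  rcases r with a | r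
  · simp
  · fin_cases r <;> simp [Pi.single_apply, Equiv.eq_symm_apply]

theorem bigMat_map {R' : Type*} [CommRing R'] (φ : R →+* R') (g : Fin s → Fin (s + 3) → R) (i j m : Fin (s + 3)) :
    φ (bigMat g i j m).det = (bigMat (fun k l => φ (g k l)) i j m).det := by
  rw [RingHom.map_det]
  congr 1
  ext r c
  rcases r with a | r
  · simp [bigMat]
  · fin_cases r <;> simp [bigMat, Pi.single_apply]
end

theorem bigMat_homog {s : ℕ} (f : Fin s → MvPolynomial (Fin (s + 3)) ℂ) (d : Fin s → ℕ)
    (hf : ∀ i, (f i).IsHomogeneous (d i)) (hd : ∀ i, 2 ≤ d i) (hsum : ∑ i, d i = s + 2) (i j m : Fin (s + 3)) :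
    (bigMat (fun k l => pderiv l (f k)) i j m).det.IsHomogeneous 2 := by
  classical
  set e : Fin s ⊕ Fin 3 → ℕ := Sum.elim (fun k => d k - 1) 0 with he
  have hs : ∑ r, e r = 2 := by
    simp only [he, Fintype.sum_sum_type, Sum.elim_inl, Sum.elim_inr]
    have : ∑ k, (d k - 1) + ∑ k : Fin s, 1 = ∑ k, d k := by
      rw [← Finset.sum_add_distrib]
      apply Finset.sum_congr rfl
      intro k _
      have := hd k
      omega
    simp at this ⊢
    omega
  have hent : ∀ r c, (bigMat (fun k l => pderiv l (f k)) i j m r c).IsHomogeneous (e r) := by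
    intro r c
    have h01 : ∀ a b : Fin (s+3), ((Pi.single a 1 : Fin (s+3) → MvPolynomial (Fin (s+3)) ℂ) b).IsHomogeneous 0 := by
      intro a b
      rw [Pi.single_apply]
      split_ifs
      · exact isHomogeneous_one _ _
      · exact isHomogeneous_zero _ _ _
    rcases r with k | r
    · exact (hf k).pderiv
    · fin_cases r <;> exact h01 _ _
  rw [Matrix.det_apply']
  apply IsHomogeneous.sum
  intro τ _
  rw [← zero_add 2]
  apply IsHomogeneous.mul
  · have : ((Equiv.Perm.sign τ : ℤ) : MvPolynomial (Fin (s+3)) ℂ) = C ((Equiv.Perm.sign τ : ℤ) : ℂ) := by simp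
    rw [this]; exact isHomogeneous_C _ _
  · rw [← hs, ← Equiv.sum_comp τ]
    exact IsHomogeneous.prod _ _ _ fun c _ => hent _ _

theorem bigMat_ne {s : ℕ} (g : Fin s → Fin (s + 3) → ℂ) (hg : (Matrix.of g).rank = s) (i j : Fin (s + 3))
    (u v : Fin (s + 3) → ℂ) (hui : u i = 1) (huj : u j = 0) (hvi : v i = 0) (hvj : v j = 1)
    (hu : ∀ k, ∑ l, g k l * u l = 0) (hv : ∀ k, ∑ l, g k l * v l = 0) :
    ∃ m, (bigMat g i j m).det ≠ 0 := by
  classical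
  by_contra! hcon
  have key : ∀ m, ∃ y : Fin (s + 3) → ℂ, y ≠ 0 ∧ (∀ k, ∑ l, g k l * y l = 0) ∧ y i = 0 ∧ y j = 0 ∧ y m = 0 := by
    intro m
    obtain ⟨z, hz0, hz⟩ := Matrix.exists_mulVec_eq_zero_iff.2 (hcon m)
    set y : Fin (s + 3) → ℂ := fun l => z (finSumFinEquiv.symm l) with hy
    have hzy : z = fun c => y (finSumFinEquiv c) := by ext c; simp [hy]
    have h1 : ∀ r, _ := fun r => (bigMat_mulVec g i j m y r).symm.trans (congrFun (hzy ▸ hz) r)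
    refine ⟨y, ?_, fun k => by simpa using h1 (Sum.inl k), by simpa using h1 (Sum.inr 0), by simpa using h1 (Sum.inr 1), by simpa using h1 (Sum.inr 2)⟩
    intro h; apply hz0; rw [hzy, h]; rfl
  obtain ⟨x, hx0, hx, hxi, hxj, -⟩ := key 0
  obtain ⟨m, hm⟩ := Function.ne_iff.1 hx0
  obtain ⟨y, hy0, hy, hyi, hyj, hym⟩ := key m
  have hK : Module.finrank ℂ (LinearMap.ker (Matrix.of g).mulVecLin) = 3 := by
    have := LinearMap.finrank_range_add_finrank_ker (Matrix.of g).mulVecLin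
    rw [← Matrix.rank, hg] at this
    simp at this
    omega
  have hmem : ∀ z : Fin (s+3) → ℂ, (∀ k, ∑ l, g k l * z l = 0) → z ∈ LinearMap.ker (Matrix.of g).mulVecLin := by
    intro z hz
    rw [LinearMap.mem_ker]
    ext k
    simpa [Matrix.mulVec, dotProduct] using hz k
  let B : Fin 4 → LinearMap.ker (Matrix.of g).mulVecLin :=
    ![⟨u, hmem u hu⟩, ⟨v, hmem v hv⟩, ⟨x, hmem x hx⟩, ⟨y, hmem y hy⟩]
  have hB : LinearIndependent ℂ B := by
    rw [Fintype.linearIndependent_iff]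
    intro c hc
    have hcc := congrArg Subtype.val hc
    simp [B, Fin.sum_univ_four] at hcc
    have e1 := congrFun hcc i
    have e2 := congrFun hcc j
    have e3 := congrFun hcc m
    simp [hui, huj, hvi, hvj, hxi, hxj, hyi, hyj] at e1 e2
    simp [e1, e2, hym] at e3
    have e3 := e3.resolve_right hm
    rw [e1, e2, e3] at hcc
    simp at hcc
    have e4 := hcc.resolve_right hy0
    intro a; fin_cases a <;> assumption
  have := hB.fintype_card_le_finrank
  rw [hK] at this
  simp at this

theorem tangent_zero {s : ℕ} (f : Fin s → MvPolynomial (Fin (s + 3)) ℂ) (d : Fin s → ℕ)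
    (hf : ∀ i, (f i).IsHomogeneous (d i)) (hd : ∀ i, 2 ≤ d i) (hsum : ∑ i, d i = s + 2)
    (hsm : ∀ v : Fin (s + 3) → ℂ, v ≠ 0 → (∀ i, eval v (f i) = 0) →
      (Matrix.of fun i j => eval v (pderiv j (f i))).rank = s)
    (i j : Fin (s + 3))
    (u v : Fin (s + 3) → ℂ) (hui : u i = 1) (huj : u j = 0) (hvi : v i = 0) (hvj : v j = 1)
    (hW : ∀ a b : ℂ, ∀ k, eval (a • u + b • v) (f k) = 0)
    (hdW : ∀ a b aa bb : ℂ, ∀ k, ∑ l, eval (a • u + b • v) (pderiv l (f k)) * (aa * u l + bb * v l) = 0)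
    (p q : Fin (s + 3) → ℂ) (hpi : p i = 0) (hpj : p j = 0) (hqi : q i = 0) (hqj : q j = 0)
    (hpq : ∀ a b : ℂ, ∀ k, ∑ l, eval (a • u + b • v) (pderiv l (f k)) * (a * p l + b * q l) = 0) :
    p = 0 ∧ q = 0 := by
  classical
  have hne : ∀ a b : ℂ, a • u + b • v ≠ 0 → ∃ m,
      eval (a • u + b • v) (bigMat (fun k l => pderiv l (f k)) i j m).det ≠ 0 := by
    intro a b hab
    obtain ⟨m, hm⟩ := bigMat_ne _ (hsm _ hab (hW a b)) i j u v hui huj hvi hvj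
      (fun k => by simpa using hdW a b 1 0 k) (fun k => by simpa using hdW a b 0 1 k)
    refine ⟨m, ?_⟩
    rw [bigMat_map]; exact hm
  set L : Fin (s + 3) → Polynomial ℂ := fun l => Polynomial.C (u l) + Polynomial.X * Polynomial.C (v l) with hL
  have hLe : ∀ (t : ℂ) F, (aeval L F).eval t = eval ((1:ℂ) • u + t • v) F := by
    intro t F
    rw [← Polynomial.coe_evalRingHom, aeval_def, hom_eval₂]
    rw [eval, coe_eval₂Hom]
    congr 1
    · ext; simp
    · ext l; simp [hL]; ring
  set D : Fin (s + 3) → Polynomial ℂ := fun m => aeval L (bigMat (fun k l => pderiv l (f k)) i j m).det with hD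
  set φ : Fin (s + 3) → Polynomial ℂ := fun l => Polynomial.C (p l) + Polynomial.X * Polynomial.C (q l) with hφ
  have hcross : ∀ m k, φ m * D k = φ k * D m := by
    intro m k
    have hmap : ∀ m, D m = (bigMat (fun k l => aeval L (pderiv l (f k))) i j m).det :=
      fun m => bigMat_map (aeval L : MvPolynomial (Fin (s+3)) ℂ →ₐ[ℂ] Polynomial ℂ).toRingHom _ i j m
    rw [hmap, hmap]
    apply bigMat_cross
    · intro k
      apply Polynomial.funext
      intro t
      rw [Polynomial.eval_finsetSum]
      simp only [Polynomial.eval_mul, hLe, hφ, Polynomial.eval_add, Polynomial.eval_C, Polynomial.eval_X]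
      simpa using hpq 1 t k
    · simp [hφ, hpi, hqi]
    · simp [hφ, hpj, hqj]
  have htop : Ideal.span (Set.range D) = ⊤ := by
    by_contra hcon
    set g := Submodule.IsPrincipal.generator (Ideal.span (Set.range D))
    have hgs : Ideal.span {g} = Ideal.span (Set.range D) := Ideal.span_singleton_generator _
    have hdv : ∀ m, g ∣ D m := by
      intro m
      rw [← Ideal.mem_span_singleton, hgs]
      exact Ideal.subset_span ⟨m, rfl⟩
    have hroot : ∃ t, g.IsRoot t := by
      by_cases hg0 : g = 0
      · exact ⟨0, by rw [hg0]; simp⟩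
      · apply IsAlgClosed.exists_root
        intro hdeg
        apply hcon
        rw [← hgs, Ideal.span_singleton_eq_top]
        exact Polynomial.isUnit_iff_degree_eq_zero.2 hdeg
    obtain ⟨t, ht⟩ := hroot
    obtain ⟨m, hm⟩ := hne 1 t (by
      intro h0
      have := congrFun h0 i
      simp [hui, hvi] at this)
    apply hm
    rw [← hLe]
    exact ht.dvd (hdv m)
  obtain ⟨b, hb⟩ : ∃ b : Fin (s+3) → Polynomial ℂ, ∑ m, b m * D m = 1 := by
    have : (1 : Polynomial ℂ) ∈ Ideal.span (Set.range D) := htop ▸ Submodule.mem_top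
    obtain ⟨b, hb⟩ := (Ideal.mem_span_range_iff_exists_fun).1 this
    exact ⟨b, hb⟩
  set c := ∑ m, b m * φ m with hc
  have hcD : ∀ m, φ m = c * D m := by
    intro m
    calc φ m = φ m * ∑ k, b k * D k := by rw [hb, mul_one]
      _ = ∑ k, b k * (φ m * D k) := by rw [Finset.mul_sum]; exact Finset.sum_congr rfl fun _ _ => by ring
      _ = ∑ k, b k * (φ k * D m) := by simp_rw [hcross m]
      _ = c * D m := by rw [hc, Finset.sum_mul]; exact Finset.sum_congr rfl fun _ _ => by ring
  obtain ⟨m, hm⟩ := hne 0 1 (by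
      intro h0
      have := congrFun h0 j
      simp [huj, hvj] at this)
  have hlc := line_coeff _ 2 (bigMat_homog f d hf hd hsum i j m) u v
  have hc0 : c = 0 := by
    by_contra hc0
    have hDm : 2 ≤ (D m).natDegree := by
      apply Polynomial.le_natDegree_of_ne_zero
      change Polynomial.coeff (aeval L _) 2 ≠ 0
      rw [hlc.2]
      simpa using hm
    have hDm0 : D m ≠ 0 := by rintro h; rw [h] at hDm; simp at hDm
    have h1 : (φ m).natDegree ≤ 1 := by simp only [hφ]; compute_degree
    rw [hcD m, Polynomial.natDegree_mul hc0 hDm0] at h1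
    omega
  have hφ0 : ∀ l, φ l = 0 := fun l => by rw [hcD, hc0, zero_mul]
  constructor
  · ext l; simpa [hφ] using congrArg (Polynomial.eval 0) (hφ0 l)
  · ext l; simpa [hφ, Polynomial.coeff_C] using congrArg (fun P => Polynomial.coeff P 1) (hφ0 l)

theorem deriv_along {σ : Type*} [Fintype σ] (F : MvPolynomial σ ℂ) (w x : σ → ℂ)
    (h : ∀ t : ℂ, eval (w + t • x) F = 0) : ∑ l, eval w (pderiv l F) * x l = 0 := by
  set L : σ → Polynomial ℂ := fun l => Polynomial.C (w l) + Polynomial.X * Polynomial.C (x l) with hL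
  have h0 : aeval L F = 0 := by
    apply Polynomial.funext
    intro t
    rw [← Polynomial.coe_evalRingHom, aeval_def, hom_eval₂, map_zero, ← h t]
    rw [eval, coe_eval₂Hom]
    congr 1
    · ext; simp
    · ext l; simp [hL]; ring
  have h1 := dual_eval F w x
  have h2 : aeval (fun l => (TrivSqZeroExt.inl (w l) + TrivSqZeroExt.inr (x l) : DualNumber ℂ)) F
      = Polynomial.aeval (DualNumber.eps : DualNumber ℂ) (aeval L F) := by
    rw [← AlgHom.comp_apply, comp_aeval]
    congr 2
    ext l <;> simp [hL, TrivSqZeroExt.algebraMap_eq_inl]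
  rw [h2, h0, map_zero] at h1
  have := congrArg TrivSqZeroExt.snd h1
  simpa using this.symm

/-- The equations of the lines in the chart `(i, j)` of the Grassmannian. -/
def chartEqs {s : ℕ} (f : Fin s → MvPolynomial (Fin (s + 3)) ℂ) (i j : Fin (s + 3)) :
    Set (MvPolynomial (Fin (s + 3) ⊕ Fin (s + 3)) ℂ) :=
  {X (Sum.inl i) - 1, X (Sum.inl j), X (Sum.inr i), X (Sum.inr j) - 1} ∪
    {F | ∃ (a b : ℂ) (k : Fin s), F = aeval (fun l => C a * X (Sum.inl l) + C b * X (Sum.inr l)) (f k)}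

theorem chart_eval {s : ℕ} (F : MvPolynomial (Fin (s + 3)) ℂ) (a b : ℂ) (z : Fin (s + 3) ⊕ Fin (s + 3) → ℂ) :
    eval z (aeval (fun l => C a * X (Sum.inl l) + C b * X (Sum.inr l)) F) =
      eval (a • (fun l => z (Sum.inl l)) + b • (fun l => z (Sum.inr l))) F := by
  rw [← MvPolynomial.coe_aeval_eq_eval, ← MvPolynomial.coe_aeval_eq_eval]
  change aeval z (aeval _ F) = aeval _ F
  rw [← AlgHom.comp_apply, comp_aeval]
  congr 2
  ext l; simp

theorem chart_mem {s : ℕ} (f : Fin s → MvPolynomial (Fin (s + 3)) ℂ) (i j : Fin (s + 3))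
    (u v : Fin (s + 3) → ℂ) (hui : u i = 1) (huj : u j = 0) (hvi : v i = 0) (hvj : v j = 1)
    (hW : ∀ a b : ℂ, ∀ k, eval (a • u + b • v) (f k) = 0) :
    ∀ F ∈ chartEqs f i j, eval (Sum.elim u v) F = 0 := by
  intro F hF
  simp only [chartEqs, Set.mem_union, Set.mem_insert_iff, Set.mem_singleton_iff, Set.mem_ofPred_eq] at hF
  rcases hF with (h | h | h | h) | ⟨a, b, k, h⟩
  · simp [h, hui]
  · simp [h, huj]
  · simp [h, hvi]
  · simp [h, hvj]
  · rw [h, chart_eval]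
    exact hW a b k

theorem chart_finite {s : ℕ} (f : Fin s → MvPolynomial (Fin (s + 3)) ℂ) (d : Fin s → ℕ)
    (hf : ∀ i, (f i).IsHomogeneous (d i)) (hd : ∀ i, 2 ≤ d i) (hsum : ∑ i, d i = s + 2)
    (hsm : ∀ v : Fin (s + 3) → ℂ, v ≠ 0 → (∀ i, eval v (f i) = 0) →
      (Matrix.of fun i j => eval v (pderiv j (f i))).rank = s)
    (i j : Fin (s + 3)) : {z | ∀ F ∈ chartEqs f i j, eval z F = 0}.Finite := by
  apply finite_zero
  intro z hz P hP
  set u : Fin (s + 3) → ℂ := fun l => z (Sum.inl l) with hu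
  set v : Fin (s + 3) → ℂ := fun l => z (Sum.inr l) with hv
  set p : Fin (s + 3) → ℂ := fun l => P (Sum.inl l) with hp
  set q : Fin (s + 3) → ℂ := fun l => P (Sum.inr l) with hq
  have hui : u i = 1 := by
    have := hz (X (Sum.inl i) - 1) (Or.inl (by simp))
    rw [map_sub, map_one, eval_X, sub_eq_zero] at this
    exact this
  have huj : u j = 0 := by
    simpa [sub_eq_zero] using hz (X (Sum.inl j)) (Or.inl (by simp))
  have hvi : v i = 0 := by
    simpa [sub_eq_zero] using hz (X (Sum.inr i)) (Or.inl (by simp))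
  have hvj : v j = 1 := by
    have := hz (X (Sum.inr j) - 1) (Or.inl (by simp))
    rw [map_sub, map_one, eval_X, sub_eq_zero] at this
    exact this
  have hpi : p i = 0 := by
    have := congrArg TrivSqZeroExt.snd (hP (X (Sum.inl i) - 1) (Or.inl (by simp)))
    simpa using this
  have hpj : p j = 0 := by
    have := congrArg TrivSqZeroExt.snd (hP (X (Sum.inl j)) (Or.inl (by simp)))
    simpa using this
  have hqi : q i = 0 := by
    have := congrArg TrivSqZeroExt.snd (hP (X (Sum.inr i)) (Or.inl (by simp)))
    simpa using this
  have hqj : q j = 0 := by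
    have := congrArg TrivSqZeroExt.snd (hP (X (Sum.inr j) - 1) (Or.inl (by simp)))
    simpa using this
  have hW : ∀ a b : ℂ, ∀ k, eval (a • u + b • v) (f k) = 0 := by
    intro a b k
    rw [← chart_eval]
    exact hz _ (Or.inr ⟨a, b, k, rfl⟩)
  have hdW : ∀ a b aa bb : ℂ, ∀ k,
      ∑ l, eval (a • u + b • v) (pderiv l (f k)) * (aa * u l + bb * v l) = 0 := by
    intro a b aa bb k
    have := deriv_along (f k) (a • u + b • v) (aa • u + bb • v) (by
      intro t
      have := hW (a + t * aa) (b + t * bb) k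
      rw [← this]
      congr 2
      ext l; simp; ring)
    simpa using this
  have hpq : ∀ a b : ℂ, ∀ k,
      ∑ l, eval (a • u + b • v) (pderiv l (f k)) * (a * p l + b * q l) = 0 := by
    intro a b k
    have h1 := hP _ (Or.inr ⟨a, b, k, rfl⟩)
    have h2 := dual_eval (f k) (a • u + b • v) (a • p + b • q)
    rw [← AlgHom.comp_apply, comp_aeval] at h1
    have h3 : (fun l => aeval (fun l => (TrivSqZeroExt.inl (z l) + TrivSqZeroExt.inr (P l) : DualNumber ℂ))
        (C a * X (Sum.inl l) + C b * X (Sum.inr l))) =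
        fun l => (TrivSqZeroExt.inl ((a • u + b • v) l) + TrivSqZeroExt.inr ((a • p + b • q) l) : DualNumber ℂ) := by
      ext l <;> simp [hu, hv, hp, hq, TrivSqZeroExt.algebraMap_eq_inl]
    rw [h3, h2] at h1
    have := congrArg TrivSqZeroExt.snd h1
    simpa using this
  obtain ⟨h1, h2⟩ := tangent_zero f d hf hd hsum hsm i j u v hui huj hvi hvj hW hdW p q hpi hpj hqi hqj hpq
  ext l
  rcases l with l | l
  · exact congrFun h1 l
  · exact congrFun h2 l

theorem exists_chart {n : ℕ} (W : Submodule ℂ (Fin n → ℂ)) (hW : Module.finrank ℂ W = 2) :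
    ∃ (i j : Fin n) (u v : Fin n → ℂ), u ∈ W ∧ v ∈ W ∧ u i = 1 ∧ u j = 0 ∧ v i = 0 ∧ v j = 1 ∧
      W = Submodule.span ℂ {u, v} := by
  let B := Module.finBasisOfFinrankEq ℂ W hW
  have hB := B.linearIndependent
  set x : Fin n → ℂ := (B 0 : Fin n → ℂ) with hx
  set y : Fin n → ℂ := (B 1 : Fin n → ℂ) with hy
  have hxW : x ∈ W := (B 0).2
  have hyW : y ∈ W := (B 1).2
  have hind : ∀ a b : ℂ, a • x + b • y = 0 → a = 0 ∧ b = 0 := by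
    intro a b hab
    have := Fintype.linearIndependent_iff.1 hB ![a, b] (by
      apply Subtype.ext
      simpa [Fin.sum_univ_two] using hab)
    exact ⟨this 0, this 1⟩
  have hx0 : x ≠ 0 := by
    intro h
    have := (hind 1 0 (by simp [h])).1
    simp at this
  obtain ⟨i, hi⟩ := Function.ne_iff.1 hx0
  have hi : x i ≠ 0 := hi
  set v0 : Fin n → ℂ := y - (y i / x i) • x with hv0
  have hv00 : v0 ≠ 0 := by
    intro h
    have := (hind (-(y i / x i)) 1 (by rw [← h, hv0]; module)).2
    simp at this
  obtain ⟨j, hj⟩ := Function.ne_iff.1 hv00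
  have hj : v0 j ≠ 0 := hj
  have hv0i : v0 i = 0 := by simp [hv0, hi]
  have hv0W : v0 ∈ W := W.sub_mem hyW (W.smul_mem _ hxW)
  set v := (v0 j)⁻¹ • v0 with hv
  have hvW : v ∈ W := W.smul_mem _ hv0W
  have hvi : v i = 0 := by simp [hv, hv0i]
  have hvj : v j = 1 := by simp [hv, hj]
  set u := (x i)⁻¹ • x - ((x i)⁻¹ * x j) • v with hu
  have huW : u ∈ W := W.sub_mem (W.smul_mem _ hxW) (W.smul_mem _ hvW)
  have hui : u i = 1 := by simp [hu, hvi, hi]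
  have huj : u j = 0 := by simp [hu, hvj]
  refine ⟨i, j, u, v, huW, hvW, hui, huj, hvi, hvj, ?_⟩
  symm
  apply Submodule.eq_of_le_of_finrank_eq
  · rw [Submodule.span_le]
    rintro w (rfl | rfl) <;> assumption
  · have hli : LinearIndependent ℂ ![u, v] := by
      rw [LinearIndependent.pair_iff]
      intro a b hab
      have e1 := congrFun hab i
      have e2 := congrFun hab j
      simp [hui, huj, hvi, hvj] at e1 e2
      exact ⟨e1, e2⟩
    have := finrank_span_eq_card hli
    rw [hW]
    have hr : Set.range ![u, v] = {u, v} := by simp [Matrix.range_cons, Matrix.range_empty, Set.pair_comm]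
    rw [hr] at this
    simpa using this

theorem eval_zero_of_line {n s : ℕ} {d : Fin s → ℕ} {f : Fin s → MvPolynomial (Fin (n + 1)) ℂ}
    {X : Set (Projectivization ℂ (Fin (n + 1) → ℂ))} (hX : IsSmoothCI n s d f X)
    (W : Submodule ℂ (Fin (n + 1) → ℂ)) (hW : lineSet W ⊆ X) (w : Fin (n + 1) → ℂ) (hw : w ∈ W) (k : Fin s) :
    eval w (f k) = 0 := by
  have hsc : ∀ (a : ℂ), eval (a • w) (f k) = a ^ d k * eval w (f k) := by
    intro a
    rw [eval_eq', eval_eq', Finset.mul_sum]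
    apply Finset.sum_congr rfl
    intro e he
    have h1 : ∑ l, e l = d k := by
      have := hX.homog k (mem_support_iff.1 he)
      rw [← this, Finsupp.weight_apply, Finsupp.sum_fintype] <;> simp
    simp only [Pi.smul_apply, smul_eq_mul, mul_pow, Finset.prod_mul_distrib, Finset.prod_pow_eq_pow_sum, h1]
    ring
  by_cases hw0 : w = 0
  · have := hsc 0
    rw [zero_pow (by have := hX.two_le_deg k; omega), zero_mul] at this
    rw [hw0] at this ⊢
    simpa using this
  · obtain ⟨a, ha⟩ := Projectivization.exists_smul_eq_mk_rep ℂ w hw0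
    have ha : (a : ℂ) • w = (Projectivization.mk ℂ w hw0).rep := ha
    have h1 : Projectivization.mk ℂ w hw0 ∈ X := by
      apply hW
      change Projectivization.rep _ ∈ W
      rw [← ha]
      exact W.smul_mem _ hw
    rw [hX.locus] at h1
    have h2 := h1 k
    rw [← ha, hsc] at h2
    exact (mul_eq_zero.1 h2).resolve_left (pow_ne_zero _ a.ne_zero)

end Helpers

/-- **Theorem.**  Let `X ⊆ ℙ^n` be a smooth complete intersection of `s = n − 2`
hypersurfaces of degrees `d_1, …, d_s ≥ 2` with `Σ d_i = n` (so `X` is a surface).  Then `X`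
contains only finitely many projective lines. -/
theorem finite_lines_on_surface
    (n s : ℕ) (d : Fin s → ℕ)
    (f : Fin s → MvPolynomial (Fin (n + 1)) ℂ)
    (X : Set (Projectivization ℂ (Fin (n + 1) → ℂ)))
    (hX : IsSmoothCI n s d f X)
    (hs : n = s + 2)
    (hd : ∑ i, d i = n) :
    (fanoLines X).Finite := by
  subst hs
  have hfin : ∀ i j : Fin (s + 2 + 1),
      {z : Fin (s + 2 + 1) ⊕ Fin (s + 2 + 1) → ℂ | ∀ F ∈ chartEqs f i j, MvPolynomial.eval z F = 0}.Finite := fun i j =>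
    chart_finite f d hX.homog hX.two_le_deg hd hX.smooth i j
  have hinj : Function.Injective
      (fun W : ProjLine (s + 2) => (W.1 : Submodule ℂ (Fin (s + 2 + 1) → ℂ))) :=
    fun W W' h => Subtype.ext h
  refine Set.Finite.of_finite_image (f := fun W : ProjLine (s + 2) => W.1) ?_ hinj.injOn
  have hU : (⋃ i : Fin (s + 2 + 1), ⋃ j : Fin (s + 2 + 1),
      (fun z : Fin (s + 2 + 1) ⊕ Fin (s + 2 + 1) → ℂ =>
        (Submodule.span ℂ {fun l => z (Sum.inl l), fun l => z (Sum.inr l)} :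
          Submodule ℂ (Fin (s + 2 + 1) → ℂ))) ''
        {z | ∀ F ∈ chartEqs f i j, MvPolynomial.eval z F = 0}).Finite :=
    (Set.finite_iUnion fun i : Fin (s + 2 + 1) => Set.finite_iUnion fun j : Fin (s + 2 + 1) =>
    (hfin i j).image _)
  refine hU.subset ?_
  rintro _ ⟨W, hW, rfl⟩
  obtain ⟨i, j, u, v, hu, hv, hui, huj, hvi, hvj, hspan⟩ := exists_chart W.1 W.2
  refine Set.mem_iUnion.2 ⟨i, Set.mem_iUnion.2 ⟨j, ?_⟩⟩
  refine (Set.mem_image _ _ _).2 ⟨Sum.elim u v, ?_, ?_⟩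
  · exact chart_mem f i j u v hui huj hvi hvj fun a b k =>
      eval_zero_of_line hX W.1 hW _ (W.1.add_mem (W.1.smul_mem _ hu) (W.1.smul_mem _ hv)) k
  · exact hspan.symm

end
end

section
/- Let X ⊂ ℙ^n be a smooth complete intersection of s hypersurfaces of degrees d_1, …, d_s with d := d_1 + ⋯ + d_s, let l ⊂ X be a projective line, and let Λ ≅ ℙ^d ⊆ ℙ^n be a linear subspace with l ⊂ Λ such that Y := Λ ∩ X is a smooth complete intersection of type (d_1,…,d_s) in Λ. Then the local dimensions of the Fano varieties of lines satisfy dim_{[l]} F(X) ≤ dim_{[l]} F(Y) + 2(n − d). In particular, if dim_{[l]} F(Y) = d − s − 2, then dim_{[l]} F(X) ≤ 2n − d − s − 2. -/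
/-! Formalization of: for a smooth complete intersection X ⊆ ℙ^n of type (d_1,…,d_s) with
d := Σ d_i ≤ n, a line l ⊆ X, and a linear subspace Λ ≅ ℙ^d containing l such that
Y := Λ ∩ X is a smooth complete intersection of the same type in Λ, the local dimensions
satisfy dim_[l] F(X) ≤ dim_[l] F(Y) + 2(n − d); in particular, if dim_[l] F(Y) = d − s − 2,
then dim_[l] F(X) ≤ 2n − d − s − 2. -/

noncomputable section

/-- The local dimension of a subset `S` of a topological space at a point `x`: the infimum,
over the open neighbourhoods `U` of `x`, of the (Krull) dimension of `S ∩ U`. -/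
def localTKDim {α : Type*} [TopologicalSpace α] (S : Set α) (x : α) : WithBot ℕ∞ :=
  ⨅ (U : Set α) (_ : IsOpen U) (_ : x ∈ U), topologicalKrullDim ↥(S ∩ U)


lemma aux_height_mvPoly (s : ℕ) (m : Ideal (MvPolynomial (Fin s) ℂ)) [hm : m.IsMaximal] :
    m.height = s := by
  induction s with
  | zero =>
    have h1 := Ideal.height_le_ringKrullDim_of_ne_top hm.ne_top
    simp at h1
    simpa using h1
  | succ s ih =>
    let e := MvPolynomial.finSuccEquiv ℂ s
    have hM : (m.map e.toRingEquiv).IsMaximal := Ideal.map_isMaximal_of_equiv e.toRingEquiv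
    have h1 := e.toRingEquiv.height_map m
    have hc : ((m.map e.toRingEquiv).under (MvPolynomial (Fin s) ℂ)).IsMaximal :=
      Polynomial.isMaximal_comap_C_of_isJacobsonRing _
    have hlo : (m.map e.toRingEquiv).LiesOver
        ((m.map e.toRingEquiv).under (MvPolynomial (Fin s) ℂ)) := ⟨rfl⟩
    rw [← h1, Polynomial.height_eq_height_add_one ((m.map e.toRingEquiv).under (MvPolynomial (Fin s) ℂ)), ih]
    simp

lemma aux_dim_le_height (B : Type) [CommRing B] [IsDomain B] [Algebra ℂ B]
    [Algebra.FiniteType ℂ B] (M : Ideal B) [hM : M.IsMaximal] :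
    ringKrullDim B ≤ M.height := by
  obtain ⟨s, g, hg, hfin⟩ := exists_finite_inj_algHom_of_fg ℂ B
  let _ : Algebra (MvPolynomial (Fin s) ℂ) B := g.toRingHom.toAlgebra
  have : Module.Finite (MvPolynomial (Fin s) ℂ) B := hfin
  have : Algebra.IsIntegral (MvPolynomial (Fin s) ℂ) B := inferInstance
  have : FaithfulSMul (MvPolynomial (Fin s) ℂ) B :=
    (faithfulSMul_iff_algebraMap_injective _ _).2 hg
  have : IsNoetherianRing B := Algebra.FiniteType.isNoetherianRing ℂ B
  have hu : (M.under (MvPolynomial (Fin s) ℂ)).IsMaximal :=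
    Ideal.isMaximal_comap_of_isIntegral_of_isMaximal M
  have h2 := Ideal.height_eq_height_add_of_liesOver_of_hasGoingDown (M.under (MvPolynomial (Fin s) ℂ)) M
  have h3 : ringKrullDim B ≤ ringKrullDim (MvPolynomial (Fin s) ℂ) := by
    apply Order.krullDim_le_of_strictMono (PrimeSpectrum.comap (algebraMap (MvPolynomial (Fin s) ℂ) B))
    intro a b hab
    exact Ideal.IsIntegral.comap_lt_comap hab
  rw [h2, aux_height_mvPoly]
  simp at h3
  refine h3.trans ?_
  norm_cast
  exact le_self_add


lemma aux_height_quot_le {A : Type} [CommRing A] (J Q m : Ideal A) [hm : m.IsPrime]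
    (hJQ : J ≤ Q) (hQm : Q ≤ m) :
    (m.map (Ideal.Quotient.mk Q)).height ≤ (m.map (Ideal.Quotient.mk J)).height := by
  have h1 : (m.map (Ideal.Quotient.mk Q)).IsPrime := Ideal.isPrime_map_quotientMk_of_isPrime hQm
  have h2 : (m.map (Ideal.Quotient.mk J)).IsPrime :=
    Ideal.isPrime_map_quotientMk_of_isPrime (hJQ.trans hQm)
  have e1 := PrimeSpectrum.height_eq_orderHeight ⟨_, h1⟩
  have e2 := PrimeSpectrum.height_eq_orderHeight ⟨_, h2⟩
  simp only at e1 e2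
  rw [e1, e2]
  have h3 := Order.height_le_height_apply_of_strictMono
    (PrimeSpectrum.comap (Ideal.Quotient.factor hJQ))
    (RingHom.strictMono_comap_of_surjective (Ideal.Quotient.factor_surjective hJQ)) ⟨_, h1⟩
  convert h3 using 2
  ext x
  obtain ⟨x, rfl⟩ := Ideal.Quotient.mk_surjective x
  simp only [PrimeSpectrum.comap_asIdeal, Ideal.mem_comap, Ideal.Quotient.factor_mk]
  rw [Ideal.mem_quotient_iff_mem hQm, Ideal.mem_quotient_iff_mem (hJQ.trans hQm)]

lemma aux_upper {σ : Type} [Finite σ] (J m : Ideal (MvPolynomial σ ℂ)) [hm : m.IsMaximal]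
    (_hJ : J ≤ m) :
    ∃ g : MvPolynomial σ ℂ, g ∉ m ∧ ∀ (T : Type) [TopologicalSpace T]
      (ψ : T → PrimeSpectrum (MvPolynomial σ ℂ)), Topology.IsInducing ψ →
      (∀ t, J ≤ (ψ t).asIdeal) → (∀ t, g ∉ (ψ t).asIdeal) →
      topologicalKrullDim T ≤ (m.map (Ideal.Quotient.mk J)).height := by
  classical
  have hfin : J.minimalPrimes.Finite := Ideal.finite_minimalPrimes_of_isNoetherianRing _ J
  have hex : ∀ Q : Ideal (MvPolynomial σ ℂ), ∃ g, g ∉ m ∧ (¬ Q ≤ m → g ∈ Q) := by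
    intro Q
    by_cases h : Q ≤ m
    · exact ⟨1, fun h1 => hm.ne_top ((Ideal.eq_top_iff_one _).2 h1), fun h' => absurd h h'⟩
    · obtain ⟨g, hg, hg'⟩ := SetLike.not_le_iff_exists.1 h
      exact ⟨g, hg', fun _ => hg⟩
  choose G hG1 hG2 using hex
  refine ⟨∏ Q ∈ hfin.toFinset, G Q, ?_, ?_⟩
  · intro h
    obtain ⟨Q, _, hQ⟩ := (hm.isPrime.prod_mem_iff).1 h
    exact hG1 Q hQ
  · intro T _ ψ hψ hTJ hTg
    rw [topologicalKrullDim, Order.krullDim_eq_iSup_height]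
    refine iSup_le fun C => ?_
    have h1 := Order.height_le_height_apply_of_strictMono _
      (TopologicalSpace.IrreducibleCloseds.map_strictMono_of_isInducing hψ) C
    set C' := TopologicalSpace.IrreducibleCloseds.map ψ hψ.continuous C with hC'
    obtain ⟨P, hP⟩ := (PrimeSpectrum.pointsEquivIrreducibleCloseds
      (MvPolynomial σ ℂ)).surjective (OrderDual.toDual C')
    have h2 : Order.height C' = Order.coheight P := by
      rw [← Order.coheight_orderIso (PrimeSpectrum.pointsEquivIrreducibleCloseds
        (MvPolynomial σ ℂ)) P, hP, Order.coheight_toDual]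
    have hCP : (C' : Set (PrimeSpectrum (MvPolynomial σ ℂ))) = closure {P} := by
      have : C' = OrderDual.ofDual (PrimeSpectrum.pointsEquivIrreducibleCloseds
        (MvPolynomial σ ℂ) P) := by rw [hP]; rfl
      rw [this]; rfl
    have hCc : (C' : Set (PrimeSpectrum (MvPolynomial σ ℂ))) = closure (ψ '' C) := rfl
    have hJP : J ≤ P.asIdeal := by
      have h3 : closure (ψ '' (C : Set T)) ⊆ PrimeSpectrum.zeroLocus (J : Set (MvPolynomial σ ℂ)) := by
        apply closure_minimal _ (PrimeSpectrum.isClosed_zeroLocus _)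
        rintro _ ⟨t, _, rfl⟩
        exact hTJ t
      have h4 : P ∈ closure (ψ '' (C : Set T)) := by
        rw [← hCc, hCP]; exact subset_closure rfl
      exact h3 h4
    obtain ⟨t, ht⟩ := C.isIrreducible.nonempty
    have hPt : P ≤ ψ t := by
      rw [PrimeSpectrum.le_iff_mem_closure, ← hCP, hCc]
      exact subset_closure ⟨t, ht, rfl⟩
    obtain ⟨Q, hQ, hQP⟩ := Ideal.exists_minimalPrimes_le hJP
    have hQm : Q ≤ m := by
      by_contra hcon
      apply hTg t
      apply hPt
      apply hQP
      exact Ideal.mem_of_dvd _ (Finset.dvd_prod_of_mem _ (hfin.mem_toFinset.2 hQ)) (hG2 Q hcon)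
    have hQp : Q.IsPrime := hQ.1.1
    have hM : (m.map (Ideal.Quotient.mk Q)).IsMaximal :=
      Ideal.IsMaximal.map_of_surjective_of_ker_le Ideal.Quotient.mk_surjective (by simpa using hQm)
    have h5 := aux_dim_le_height (MvPolynomial σ ℂ ⧸ Q) (m.map (Ideal.Quotient.mk Q))
    have h6 : (Order.coheight P : WithBot ℕ∞) ≤ ringKrullDim (MvPolynomial σ ℂ ⧸ Q) := by
      rw [ringKrullDim_quotient]
      calc (Order.coheight P : WithBot ℕ∞) ≤ Order.coheight (⟨Q, hQp⟩ : PrimeSpectrum (MvPolynomial σ ℂ)) :=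
            WithBot.coe_le_coe.2 (Order.coheight_anti hQP)
        _ = _ := by
            rw [Order.coheight_eq_krullDim_Ici]
            rfl
    calc (Order.height C : WithBot ℕ∞) ≤ Order.height C' := WithBot.coe_le_coe.2 h1
      _ = Order.coheight P := by rw [h2]
      _ ≤ _ := h6
      _ ≤ _ := h5
      _ ≤ _ := WithBot.coe_le_coe.2 (aux_height_quot_le J Q m hQ.1.2 hQm)

lemma aux_preirr {X Y : Type} [TopologicalSpace X] [TopologicalSpace Y] {f : X → Y}
    (hf : Topology.IsInducing f) (s : Set X) (h : IsIrreducible (f '' s)) : IsIrreducible s := by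
  refine ⟨Set.image_nonempty.1 h.1, ?_⟩
  intro u v hu hv hsu hsv
  obtain ⟨u', hu', rfl⟩ := hf.isOpen_iff.1 hu
  obtain ⟨v', hv', rfl⟩ := hf.isOpen_iff.1 hv
  obtain ⟨a, ha, ha'⟩ := hsu
  obtain ⟨b, hb, hb'⟩ := hsv
  obtain ⟨_, ⟨c, hc, rfl⟩, hc'⟩ := h.2 u' v' hu' hv' ⟨f a, ⟨a, ha, rfl⟩, ha'⟩ ⟨f b, ⟨b, hb, rfl⟩, hb'⟩
  exact ⟨c, hc, hc'⟩

lemma aux_lower {σ : Type} [Finite σ] {B : Type} [CommRing B] (π : MvPolynomial σ ℂ →+* B)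
    (hπ : Function.Surjective π) (M : PrimeSpectrum B)
    (O : Set (PrimeSpectrum (MvPolynomial σ ℂ))) (hO : IsOpen O)
    (hM : PrimeSpectrum.comap π M ∈ O)
    (T : Type) [TopologicalSpace T] (ψ : T → PrimeSpectrum (MvPolynomial σ ℂ))
    (hψ : Topology.IsInducing ψ)
    (hsurj : ∀ x : σ → ℂ, MvPolynomial.pointToPoint x ∈ O →
      RingHom.ker π ≤ (MvPolynomial.pointToPoint x : PrimeSpectrum (MvPolynomial σ ℂ)).asIdeal →
      ∃ t, ψ t = MvPolynomial.pointToPoint x) :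
    (M.asIdeal.height : WithBot ℕ∞) ≤ topologicalKrullDim T := by
  have key : ∀ P : PrimeSpectrum B, P ≤ M →
      closure (ψ '' (ψ ⁻¹' PrimeSpectrum.zeroLocus ((PrimeSpectrum.comap π P).asIdeal : Set (MvPolynomial σ ℂ)))) =
      PrimeSpectrum.zeroLocus ((PrimeSpectrum.comap π P).asIdeal : Set (MvPolynomial σ ℂ)) := by
    intro P hP
    apply subset_antisymm
    · exact closure_minimal (Set.image_preimage_subset _ _) (PrimeSpectrum.isClosed_zeroLocus _)
    set Z := PrimeSpectrum.zeroLocus ((PrimeSpectrum.comap π P).asIdeal : Set (MvPolynomial σ ℂ)) with hZ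
    have hirr : IsIrreducible Z :=
      (PrimeSpectrum.isIrreducible_zeroLocus_iff_of_radical _ (PrimeSpectrum.comap π P).2.isRadical).2
        (PrimeSpectrum.comap π P).2
    have hZO : (Z ∩ O).Nonempty := ⟨_, Ideal.comap_mono hP, hM⟩
    have h1 : Z ⊆ closure (Z ∩ O) :=
      subset_closure_inter_of_isPreirreducible_of_isOpen hirr.2 hO hZO
    have hlc : IsLocallyClosed (Z ∩ O) :=
      (PrimeSpectrum.isClosed_zeroLocus _).isLocallyClosed.inter hO.isLocallyClosed
    rw [← JacobsonSpace.closure_inter_closedPoints_eq_closure hlc] at h1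
    refine h1.trans (closure_mono ?_)
    rintro y ⟨⟨hyZ, hyO⟩, hyc⟩
    have hmax : y.asIdeal.IsMaximal := (PrimeSpectrum.isClosed_singleton_iff_isMaximal _).1 hyc
    obtain ⟨x, hx⟩ := MvPolynomial.isMaximal_iff_eq_vanishingIdeal_singleton.1 hmax
    have hy : y = MvPolynomial.pointToPoint x := PrimeSpectrum.ext hx
    rw [hy] at hyO
    obtain ⟨t, ht⟩ := hsurj x hyO (by
      rw [← hy]
      refine le_trans ?_ hyZ
      intro a ha
      change π a ∈ P.asIdeal
      rw [(RingHom.mem_ker).1 ha]; exact zero_mem _)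
    refine ⟨t, ?_, ht.trans hy.symm⟩
    change ψ t ∈ Z
    rw [ht, ← hy]; exact hyZ
  rw [PrimeSpectrum.height_eq_orderHeight, Order.height_eq_krullDim_Iic, ← Order.krullDim_orderDual]
  let F : Set.Iic M → TopologicalSpace.IrreducibleCloseds T := fun P =>
    ⟨ψ ⁻¹' PrimeSpectrum.zeroLocus ((PrimeSpectrum.comap π P.1).asIdeal : Set (MvPolynomial σ ℂ)),
      aux_preirr hψ _ (by
        rw [← isIrreducible_iff_closure, key P.1 P.2]
        exact (PrimeSpectrum.isIrreducible_zeroLocus_iff_of_radical _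
          (PrimeSpectrum.comap π P.1).2.isRadical).2 (PrimeSpectrum.comap π P.1).2),
      (PrimeSpectrum.isClosed_zeroLocus _).preimage hψ.continuous⟩
  have hFc : ∀ P, (F P : Set T) = ψ ⁻¹' PrimeSpectrum.zeroLocus
      ((PrimeSpectrum.comap π P.1).asIdeal : Set (MvPolynomial σ ℂ)) := fun P => rfl
  have hF : ∀ P Q, F P ≤ F Q ↔ Q ≤ P := by
    intro P Q
    constructor
    · intro h
      have h1 := closure_mono (Set.image_mono (f := ψ) h)
      rw [hFc, hFc, key P.1 P.2, key Q.1 Q.2] at h1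
      have h2 : (PrimeSpectrum.comap π Q.1).asIdeal ≤ (PrimeSpectrum.comap π P.1).asIdeal :=
        h1 (show PrimeSpectrum.comap π P.1 ∈ _ from (Set.Subset.refl _))
      exact (Ideal.comap_le_comap_iff_of_surjective π hπ _ _).1 h2
    · intro h
      rw [← SetLike.coe_subset_coe, hFc, hFc]
      refine Set.preimage_mono (PrimeSpectrum.zeroLocus_anti_mono ?_)
      exact Ideal.comap_mono (f := π) (show Q.1.asIdeal ≤ P.1.asIdeal from h)
  refine Order.krullDim_le_of_strictMono (fun P => F (OrderDual.ofDual P)) ?_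
  intro P Q h
  rw [lt_iff_le_not_ge] at h ⊢
  exact ⟨(hF _ _).2 h.1, fun h' => h.2 ((hF _ _).1 h')⟩

lemma aux_core {σ : Type} [Finite σ] (J : Ideal (MvPolynomial σ ℂ)) (p : σ → ℂ)
    (hJ : ∀ a ∈ J, MvPolynomial.eval p a = 0) {κ : Type} [Fintype κ]
    (L : κ → MvPolynomial σ ℂ) (hL : ∀ k, MvPolynomial.eval p (L k) = 0) :
    ∃ (g : MvPolynomial σ ℂ) (h h' : ℕ∞), MvPolynomial.eval p g ≠ 0 ∧
      h ≤ h' + (Fintype.card κ : ℕ∞) ∧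
      (∀ (T : Type) [TopologicalSpace T] (φ : T → σ → ℂ),
        Topology.IsInducing (fun t => (MvPolynomial.pointToPoint (φ t) : PrimeSpectrum (MvPolynomial σ ℂ))) →
        (∀ t, ∀ a ∈ J, MvPolynomial.eval (φ t) a = 0) →
        (∀ t, MvPolynomial.eval (φ t) g ≠ 0) → topologicalKrullDim T ≤ h) ∧
      (∀ (T : Type) [TopologicalSpace T] (φ : T → σ → ℂ)
        (O : Set (PrimeSpectrum (MvPolynomial σ ℂ))), IsOpen O → MvPolynomial.pointToPoint p ∈ O →
        Topology.IsInducing (fun t => (MvPolynomial.pointToPoint (φ t) : PrimeSpectrum (MvPolynomial σ ℂ))) →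
        (∀ x : σ → ℂ, MvPolynomial.pointToPoint x ∈ O → (∀ a ∈ J, MvPolynomial.eval x a = 0) →
          (∀ k, MvPolynomial.eval x (L k) = 0) → ∃ t, φ t = x) →
        (h' : WithBot ℕ∞) ≤ topologicalKrullDim T) := by
  set m : Ideal (MvPolynomial σ ℂ) := MvPolynomial.vanishingIdeal ℂ {p} with hm
  have hmm : m.IsMaximal := inferInstance
  have hmem : ∀ x a, a ∈ (MvPolynomial.vanishingIdeal ℂ {x} : Ideal (MvPolynomial σ ℂ)) ↔
    MvPolynomial.eval x a = 0 := by
    intro x a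
    rw [MvPolynomial.mem_vanishingIdeal_singleton_iff]; rfl
  have hJm : J ≤ m := fun a ha => (hmem _ _).2 (hJ a ha)
  obtain ⟨g, hg, hup⟩ := aux_upper J m hJm
  have hp1 : (m.map (Ideal.Quotient.mk J)).IsPrime := Ideal.isPrime_map_quotientMk_of_isPrime hJm
  let S : Set (MvPolynomial σ ℂ ⧸ J) := Set.range fun k => Ideal.Quotient.mk J (L k)
  have hS : S ⊆ (m.map (Ideal.Quotient.mk J) : Ideal _) := by
    rintro _ ⟨k, rfl⟩
    exact Ideal.mem_map_of_mem _ ((hmem _ _).2 (hL k))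
  have h1 := Ideal.height_le_height_add_encard_of_subset S hS
  have hS' : Ideal.span S ≤ m.map (Ideal.Quotient.mk J) := Ideal.span_le.2 hS
  have hp2 := Ideal.isPrime_map_quotientMk_of_isPrime hS'
  have h2 : S.encard ≤ Fintype.card κ := by
    have := Set.encard_le_encard (Set.image_univ (f := fun k => Ideal.Quotient.mk J (L k))).ge
    refine this.trans ((Set.encard_image_le _ _).trans ?_)
    simp [Set.encard_univ]
  refine ⟨g, (m.map (Ideal.Quotient.mk J)).height, _, fun h => hg ((hmem _ _).2 h),
    h1.trans (add_le_add_right h2 _), ?_, ?_⟩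
  · intro T _ φ hind hTJ hTg
    exact hup T _ hind (fun t a ha => (hmem _ _).2 (hTJ t a ha))
      (fun t h => hTg t ((hmem _ _).1 h))
  · intro T _ φ O hO hpO hind hs
    let M : PrimeSpectrum ((MvPolynomial σ ℂ ⧸ J) ⧸ Ideal.span S) := ⟨_, hp2⟩
    let π : MvPolynomial σ ℂ →+* ((MvPolynomial σ ℂ ⧸ J) ⧸ Ideal.span S) :=
      (Ideal.Quotient.mk (Ideal.span S)).comp (Ideal.Quotient.mk J)
    have hπ : ∀ a, π a = Ideal.Quotient.mk (Ideal.span S) (Ideal.Quotient.mk J a) := fun _ => rfl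
    have hM : PrimeSpectrum.comap π M = MvPolynomial.pointToPoint p := by
      ext a
      simp only [PrimeSpectrum.comap_asIdeal, Ideal.mem_comap, hπ]
      change _ ∈ Ideal.map _ _ ↔ _
      rw [Ideal.mem_quotient_iff_mem hS', Ideal.mem_quotient_iff_mem hJm]
      rfl
    have hπs : Function.Surjective π := by
      intro b
      obtain ⟨b, rfl⟩ := Ideal.Quotient.mk_surjective b
      obtain ⟨b, rfl⟩ := Ideal.Quotient.mk_surjective b
      exact ⟨b, rfl⟩
    have hMO : PrimeSpectrum.comap π M ∈ O := by rw [hM]; exact hpO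
    suffices hfin : ∀ x : σ → ℂ, MvPolynomial.pointToPoint x ∈ O →
      RingHom.ker π ≤ (MvPolynomial.pointToPoint x : PrimeSpectrum (MvPolynomial σ ℂ)).asIdeal →
      ∃ t, (fun t => (MvPolynomial.pointToPoint (φ t) : PrimeSpectrum (MvPolynomial σ ℂ))) t
        = MvPolynomial.pointToPoint x by
      have h3 := aux_lower (B := (MvPolynomial σ ℂ ⧸ J) ⧸ Ideal.span S) π hπs M
      exact h3 O hO hMO T _ hind hfin
    intro x hxO hx
    obtain ⟨t, ht⟩ := hs x hxO
      (fun a ha => (hmem _ _).1 (hx (by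
        rw [RingHom.mem_ker, hπ, Ideal.Quotient.eq_zero_iff_mem.2 ha, map_zero])))
      (fun k => (hmem _ _).1 (hx (by
        rw [RingHom.mem_ker, hπ, Ideal.Quotient.eq_zero_iff_mem]
        exact Ideal.subset_span ⟨k, rfl⟩)))
    exact ⟨t, by simp only [ht]⟩

def auxPF {σ : Type} (f : (σ → ℂ) → ℂ) : Prop :=
  ∃ P : MvPolynomial σ ℂ, ∀ x, MvPolynomial.eval x P = f x

lemma auxPF.const {σ : Type} (c : ℂ) : auxPF (fun _ : σ → ℂ => c) :=
  ⟨MvPolynomial.C c, fun x => by simp⟩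

lemma auxPF.coord {σ : Type} (i : σ) : auxPF (fun x : σ → ℂ => x i) :=
  ⟨MvPolynomial.X i, fun x => by simp⟩

lemma auxPF.add {σ : Type} {f g : (σ → ℂ) → ℂ} (hf : auxPF f) (hg : auxPF g) :
    auxPF (fun x => f x + g x) := by
  obtain ⟨P, hP⟩ := hf
  obtain ⟨Q, hQ⟩ := hg
  exact ⟨P + Q, fun x => by simp [hP, hQ]⟩

lemma auxPF.mul {σ : Type} {f g : (σ → ℂ) → ℂ} (hf : auxPF f) (hg : auxPF g) :
    auxPF (fun x => f x * g x) := by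
  obtain ⟨P, hP⟩ := hf
  obtain ⟨Q, hQ⟩ := hg
  exact ⟨P * Q, fun x => by simp [hP, hQ]⟩

lemma auxPF.sub {σ : Type} {f g : (σ → ℂ) → ℂ} (hf : auxPF f) (hg : auxPF g) :
    auxPF (fun x => f x - g x) := by
  obtain ⟨P, hP⟩ := hf
  obtain ⟨Q, hQ⟩ := hg
  exact ⟨P - Q, fun x => by simp [hP, hQ]⟩

lemma auxPF.pow {σ : Type} {f : (σ → ℂ) → ℂ} (hf : auxPF f) (k : ℕ) :
    auxPF (fun x => f x ^ k) := by
  obtain ⟨P, hP⟩ := hf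
  exact ⟨P ^ k, fun x => by simp [hP]⟩

lemma auxPF.sum {σ : Type} {m : ℕ} {f : Fin m → (σ → ℂ) → ℂ} (hf : ∀ i, auxPF (f i)) :
    auxPF (fun x => ∑ i, f i x) := by
  choose P hP using hf
  exact ⟨∑ i, P i, fun x => by simp [hP]⟩

lemma auxPF.comp {σ τ : Type} (F : MvPolynomial τ ℂ) {c : (σ → ℂ) → τ → ℂ}
    (hc : ∀ i, auxPF (fun x => c x i)) : auxPF (fun x => MvPolynomial.eval (c x) F) := by
  choose P hP using hc
  refine ⟨MvPolynomial.bind₁ P F, fun x => ?_⟩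
  have h1 : (fun i => MvPolynomial.eval x (P i)) = c x := funext fun i => hP i x
  have h2 := MvPolynomial.eval₂Hom_bind₁ (RingHom.id ℂ) x P F
  change _ = MvPolynomial.eval (fun i => MvPolynomial.eval x (P i)) F at h2
  rw [h1] at h2
  exact h2

/-- linear maps of polynomial vectors are polynomial -/
lemma auxPF.lin {σ : Type} {m : ℕ} (q : (Fin m → ℂ) →ₗ[ℂ] ℂ) {c : (σ → ℂ) → Fin m → ℂ}
    (hc : ∀ i, auxPF (fun x => c x i)) : auxPF (fun x => q (c x)) := by
  have : (fun x => q (c x)) = fun x => ∑ i, c x i * q (Pi.single i 1) := by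
    ext x
    conv_lhs => rw [pi_eq_sum_univ' (c x), map_sum]
    refine Finset.sum_congr rfl fun i _ => ?_
    rw [map_smul, smul_eq_mul]
  rw [this]
  exact auxPF.sum fun i => (hc i).mul (auxPF.const _)

abbrev auxI (n : ℕ) := Fin (n + 1) ⊕ Fin (n + 1)

def auxL {n : ℕ} (z : auxI n → ℂ) : Fin (n + 1) → ℂ := fun i => z (Sum.inl i)
def auxR {n : ℕ} (z : auxI n → ℂ) : Fin (n + 1) → ℂ := fun i => z (Sum.inr i)

lemma auxL_pf {n : ℕ} (i) : auxPF (fun z : auxI n → ℂ => auxL z i) := auxPF.coord _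
lemma auxR_pf {n : ℕ} (i) : auxPF (fun z : auxI n → ℂ => auxR z i) := auxPF.coord _

@[simp] lemma auxL_elim {n : ℕ} (u v : Fin (n + 1) → ℂ) : auxL (Sum.elim u v) = u := rfl
@[simp] lemma auxR_elim {n : ℕ} (u v : Fin (n + 1) → ℂ) : auxR (Sum.elim u v) = v := rfl
lemma aux_elim {n : ℕ} (z : auxI n → ℂ) : Sum.elim (auxL z) (auxR z) = z := by
  ext i; cases i <;> rfl

structure auxNrm {n : ℕ} (q1 q2 : (Fin (n + 1) → ℂ) →ₗ[ℂ] ℂ) (z : auxI n → ℂ) : Prop where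
  a : q1 (auxL z) = 1
  b : q2 (auxL z) = 0
  c : q1 (auxR z) = 0
  d : q2 (auxR z) = 1

structure auxFr {n : ℕ} (q1 q2 : (Fin (n + 1) → ℂ) →ₗ[ℂ] ℂ) (V : ProjLine n) (z : auxI n → ℂ) :
    Prop where
  nrm : auxNrm q1 q2 z
  memL : auxL z ∈ V.1
  memR : auxR z ∈ V.1
  spn : ∀ x ∈ V.1, x = q1 x • auxL z + q2 x • auxR z

lemma auxFr.unique {n : ℕ} {q1 q2 : (Fin (n + 1) → ℂ) →ₗ[ℂ] ℂ} {V : ProjLine n}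
    {z z' : auxI n → ℂ} (h : auxFr q1 q2 V z) (h' : auxFr q1 q2 V z') : z = z' := by
  have h1 := h.spn _ h'.memL
  have h2 := h.spn _ h'.memR
  rw [h'.nrm.a, h'.nrm.b] at h1
  rw [h'.nrm.c, h'.nrm.d] at h2
  rw [← aux_elim z, ← aux_elim z', h1, h2]
  simp

lemma aux_detPF {n : ℕ} (q1 q2 : (Fin (n + 1) → ℂ) →ₗ[ℂ] ℂ) :
    auxPF (fun z : auxI n → ℂ => q1 (auxL z) * q2 (auxR z) - q2 (auxL z) * q1 (auxR z)) :=
  ((auxPF.lin q1 auxL_pf).mul (auxPF.lin q2 auxR_pf)).sub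
    ((auxPF.lin q2 auxL_pf).mul (auxPF.lin q1 auxR_pf))

def auxU0 {n : ℕ} (q1 q2 : (Fin (n + 1) → ℂ) →ₗ[ℂ] ℂ) : Set (ProjLine n) :=
  {V | ∃ x ∈ V.1, ∃ y ∈ V.1, q1 x * q2 y - q2 x * q1 y ≠ 0}

lemma auxU0_open {n : ℕ} (q1 q2 : (Fin (n + 1) → ℂ) →ₗ[ℂ] ℂ) : IsOpen (auxU0 q1 q2) := by
  obtain ⟨P, hP⟩ := aux_detPF q1 q2
  apply TopologicalSpace.isOpen_generateFrom_of_mem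
  refine ⟨P, ?_⟩
  ext V
  simp only [auxU0, Set.mem_ofPred_eq, hP, auxL_elim, auxR_elim]
  push Not
  rfl

lemma auxU0_of_nrm {n : ℕ} {q1 q2 : (Fin (n + 1) → ℂ) →ₗ[ℂ] ℂ} {V : ProjLine n}
    {z : auxI n → ℂ} (h : auxNrm q1 q2 z) (hl : auxL z ∈ V.1) (hr : auxR z ∈ V.1) :
    V ∈ auxU0 q1 q2 :=
  ⟨_, hl, _, hr, by rw [h.a, h.b, h.c, h.d]; norm_num⟩

lemma auxFr_of_nrm {n : ℕ} {q1 q2 : (Fin (n + 1) → ℂ) →ₗ[ℂ] ℂ} {V : ProjLine n}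
    {z : auxI n → ℂ} (h : auxNrm q1 q2 z) (hl : auxL z ∈ V.1) (hr : auxR z ∈ V.1) :
    auxFr q1 q2 V z := by
  refine ⟨h, hl, hr, fun x hx => ?_⟩
  let Q : V.1 →ₗ[ℂ] (ℂ × ℂ) := (q1.prod q2).comp V.1.subtype
  have hfr : Module.finrank ℂ V.1 = Module.finrank ℂ (ℂ × ℂ) := by
    rw [V.2]; simp
  have : FiniteDimensional ℂ V.1 := inferInstance
  have hs : Function.Surjective Q := by
    rintro ⟨a, b⟩
    refine ⟨a • ⟨_, hl⟩ + b • ⟨_, hr⟩, ?_⟩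
    simp [Q, h.a, h.b, h.c, h.d]
  have hi : Function.Injective Q := (LinearMap.injective_iff_surjective_of_finrank_eq_finrank hfr).2 hs
  have h1 : (⟨x, hx⟩ : V.1) = q1 x • ⟨_, hl⟩ + q2 x • ⟨_, hr⟩ := by
    apply hi
    simp [Q, h.a, h.b, h.c, h.d]
  exact congrArg Subtype.val h1

lemma auxFr_exists {n : ℕ} {q1 q2 : (Fin (n + 1) → ℂ) →ₗ[ℂ] ℂ} {V : ProjLine n}
    (hV : V ∈ auxU0 q1 q2) : ∃ z, auxFr q1 q2 V z := by
  obtain ⟨x, hx, y, hy, hd⟩ := hV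
  set δ := q1 x * q2 y - q2 x * q1 y with hδ
  refine ⟨Sum.elim (δ⁻¹ • (q2 y • x - q2 x • y)) (δ⁻¹ • (q1 x • y - q1 y • x)),
    auxFr_of_nrm ⟨?_, ?_, ?_, ?_⟩ ?_ ?_⟩
  · simp only [auxL_elim, map_smul, map_sub, smul_eq_mul]; field_simp; rw [hδ]; ring
  · simp only [auxL_elim, map_smul, map_sub, smul_eq_mul]; ring
  · simp only [auxR_elim, map_smul, map_sub, smul_eq_mul]; ring
  · simp only [auxR_elim, map_smul, map_sub, smul_eq_mul]; field_simp; rw [hδ]; ring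
  · exact V.1.smul_mem _ (V.1.sub_mem (V.1.smul_mem _ hx) (V.1.smul_mem _ hy))
  · exact V.1.smul_mem _ (V.1.sub_mem (V.1.smul_mem _ hy) (V.1.smul_mem _ hx))

lemma aux_homogenize {n : ℕ} (q1 q2 : (Fin (n + 1) → ℂ) →ₗ[ℂ] ℂ) (G : MvPolynomial (auxI n) ℂ) :
    ∃ (k : ℕ) (F : MvPolynomial (auxI n) ℂ), ∀ z, auxNrm q1 q2 z → ∀ a b c d : ℂ,
      MvPolynomial.eval (Sum.elim (a • auxL z + b • auxR z) (c • auxL z + d • auxR z)) F =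
        (a * d - b * c) ^ k * MvPolynomial.eval z G := by
  obtain ⟨P, hP⟩ := aux_detPF q1 q2
  have hP' : ∀ z, auxNrm q1 q2 z → ∀ a b c d : ℂ,
      MvPolynomial.eval (Sum.elim (a • auxL z + b • auxR z) (c • auxL z + d • auxR z)) P =
        (a * d - b * c) := by
    intro z hz a b c d
    rw [hP]
    simp [hz.a, hz.b, hz.c, hz.d]
  induction G using MvPolynomial.induction_on with
  | C c => exact ⟨0, MvPolynomial.C c, fun z _ a b c d => by simp⟩
  | add p q hp hq =>
    obtain ⟨k1, F1, h1⟩ := hp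
    obtain ⟨k2, F2, h2⟩ := hq
    refine ⟨k1 + k2, F1 * P ^ k2 + F2 * P ^ k1, fun z hz a b c d => ?_⟩
    rw [map_add, map_mul, map_mul, map_pow, map_pow, h1 z hz, h2 z hz, hP' z hz, map_add]
    ring
  | mul_X p i hp =>
    obtain ⟨k, F, h⟩ := hp
    have hi : ∃ E : MvPolynomial (auxI n) ℂ, ∀ z, auxNrm q1 q2 z → ∀ a b c d : ℂ,
        MvPolynomial.eval (Sum.elim (a • auxL z + b • auxR z) (c • auxL z + d • auxR z)) E =
        (a * d - b * c) * z i := by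
      cases i with
      | inl i =>
        obtain ⟨E, hE⟩ : auxPF (fun z : auxI n → ℂ => q2 (auxR z) * auxL z i - q2 (auxL z) * auxR z i) :=
          ((auxPF.lin q2 auxR_pf).mul (auxL_pf i)).sub ((auxPF.lin q2 auxL_pf).mul (auxR_pf i))
        refine ⟨E, fun z hz a b c d => ?_⟩
        rw [hE]
        simp [hz.a, hz.b, hz.c, hz.d]
        simp only [auxL, auxR]
        ring
      | inr i =>
        obtain ⟨E, hE⟩ : auxPF (fun z : auxI n → ℂ => q1 (auxL z) * auxR z i - q1 (auxR z) * auxL z i) :=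
          ((auxPF.lin q1 auxL_pf).mul (auxR_pf i)).sub ((auxPF.lin q1 auxR_pf).mul (auxL_pf i))
        refine ⟨E, fun z hz a b c d => ?_⟩
        rw [hE]
        simp [hz.a, hz.b, hz.c, hz.d]
        simp only [auxL, auxR]
        ring
    obtain ⟨E, hE⟩ := hi
    refine ⟨k + 1, F * E, fun z hz a b c d => ?_⟩
    rw [map_mul, h z hz, hE z hz, map_mul, MvPolynomial.eval_X]
    ring

lemma aux_pull {n : ℕ} (q1 q2 : (Fin (n + 1) → ℂ) →ₗ[ℂ] ℂ) (G : MvPolynomial (auxI n) ℂ) :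
    ∃ F : MvPolynomial (auxI n) ℂ, ∀ V z, auxFr q1 q2 V z →
      ((∀ x ∈ V.1, ∀ y ∈ V.1, MvPolynomial.eval (Sum.elim x y) F = 0) ↔ MvPolynomial.eval z G = 0) := by
  obtain ⟨k, F, hF⟩ := aux_homogenize q1 q2 G
  obtain ⟨P, hP⟩ := aux_detPF q1 q2
  refine ⟨F * P, fun V z hz => ⟨fun h => ?_, fun h x hx y hy => ?_⟩⟩
  · have h1 := h _ hz.memL _ hz.memR
    have h2 := hF z hz.nrm 1 0 0 1
    simp only [one_smul, zero_smul, add_zero, zero_add] at h2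
    rw [map_mul, h2, hP] at h1
    simpa [hz.nrm.a, hz.nrm.b, hz.nrm.c, hz.nrm.d] using h1
  · rw [map_mul, hz.spn x hx, hz.spn y hy, hF z hz.nrm, h]
    simp

lemma aux_mem_pt {σ : Type} (z : σ → ℂ) (P : MvPolynomial σ ℂ) :
    P ∈ (MvPolynomial.pointToPoint z : PrimeSpectrum (MvPolynomial σ ℂ)).asIdeal ↔
      MvPolynomial.eval z P = 0 := by
  change P ∈ (MvPolynomial.vanishingIdeal ℂ {z} : Ideal (MvPolynomial σ ℂ)) ↔ _
  rw [MvPolynomial.mem_vanishingIdeal_singleton_iff]; rfl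

lemma aux_chart_inducing {n : ℕ} (q1 q2 : (Fin (n + 1) → ℂ) →ₗ[ℂ] ℂ) {T : Type}
    [inst : TopologicalSpace T] (τ : T → ProjLine n) (hτ : Topology.IsInducing τ)
    (φ : T → auxI n → ℂ) (hφ : ∀ t, auxFr q1 q2 (τ t) (φ t)) :
    Topology.IsInducing
      (fun t => (MvPolynomial.pointToPoint (φ t) : PrimeSpectrum (MvPolynomial (auxI n) ℂ))) := by
  constructor
  apply le_antisymm
  · rw [← continuous_iff_le_induced]
    refine PrimeSpectrum.isTopologicalBasis_basic_opens.continuous_iff.2 ?_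
    rintro _ ⟨G, rfl⟩
    obtain ⟨F, hF⟩ := aux_pull q1 q2 G
    have h1 : IsOpen {W : ProjLine n | ¬ ∀ u ∈ W.1, ∀ v ∈ W.1, MvPolynomial.eval (Sum.elim u v) F = 0} :=
      TopologicalSpace.isOpen_generateFrom_of_mem ⟨F, rfl⟩
    convert h1.preimage hτ.continuous using 1
    ext t
    simp only [Set.mem_preimage, Set.mem_ofPred_eq, hF _ _ (hφ t), SetLike.mem_coe,
      PrimeSpectrum.mem_basicOpen, aux_mem_pt]
  · rw [hτ.eq_induced, grassZariski, induced_generateFrom_eq]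
    apply le_generateFrom
    rintro _ ⟨_, ⟨F, rfl⟩, rfl⟩
    let S : Set (MvPolynomial (auxI n) ℂ) := {P | ∃ a b c d : ℂ, ∀ z, MvPolynomial.eval z P =
      MvPolynomial.eval (Sum.elim (a • auxL z + b • auxR z) (c • auxL z + d • auxR z)) F}
    refine isOpen_induced_iff.2 ⟨(PrimeSpectrum.zeroLocus S)ᶜ,
      (PrimeSpectrum.isClosed_zeroLocus S).isOpen_compl, ?_⟩
    ext t
    simp only [Set.mem_preimage, Set.mem_compl_iff, Set.mem_ofPred_eq]
    rw [not_iff_not]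
    constructor
    · intro h x hx y hy
      obtain ⟨P, hP⟩ : auxPF (fun z : auxI n → ℂ => MvPolynomial.eval (Sum.elim
          (q1 x • auxL z + q2 x • auxR z) (q1 y • auxL z + q2 y • auxR z)) F) := by
        apply auxPF.comp
        rintro (i | i)
        · exact ((auxPF.const _).mul (auxL_pf i)).add ((auxPF.const _).mul (auxR_pf i))
        · exact ((auxPF.const _).mul (auxL_pf i)).add ((auxPF.const _).mul (auxR_pf i))
      have h1 := (aux_mem_pt _ _).1 (h (show P ∈ S from ⟨_, _, _, _, hP⟩))
      rw [hP] at h1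
      beta_reduce at h1
      rw [← (hφ t).spn x hx, ← (hφ t).spn y hy] at h1
      exact h1
    · rintro h P ⟨a, b, c, d, hP⟩
      rw [SetLike.mem_coe, aux_mem_pt, hP]
      have hl := (hφ t).memL
      have hr := (hφ t).memR
      exact h _ (add_mem (Submodule.smul_mem _ _ hl) (Submodule.smul_mem _ _ hr))
        _ (add_mem (Submodule.smul_mem _ _ hl) (Submodule.smul_mem _ _ hr))

lemma aux_eval_smul {n k : ℕ} {f : MvPolynomial (Fin (n + 1)) ℂ} (hf : f.IsHomogeneous k) (c : ℂ)
    (v : Fin (n + 1) → ℂ) : MvPolynomial.eval (c • v) f = c ^ k * MvPolynomial.eval v f := by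
  rw [MvPolynomial.eval_eq', MvPolynomial.eval_eq', Finset.mul_sum]
  refine Finset.sum_congr rfl fun e he => ?_
  have h1 := hf (MvPolynomial.mem_support_iff.1 he)
  have h0 : e.degree = Finsupp.weight 1 e := by
    exact DFunLike.congr_fun (Finsupp.degree_eq_weight_one (σ := Fin (n + 1)) (R := ℕ)) e
  rw [← h0, Finsupp.degree_eq_sum] at h1
  simp only [Pi.smul_apply, smul_eq_mul, mul_pow]
  rw [Finset.prod_mul_distrib, Finset.prod_pow_eq_pow_sum, h1]
  ring

lemma aux_fano_iff {n s : ℕ} {d : Fin s → ℕ} {f : Fin s → MvPolynomial (Fin (n + 1)) ℂ}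
    {X : Set (Projectivization ℂ (Fin (n + 1) → ℂ))} (hX : IsSmoothCI n s d f X)
    (V : Submodule ℂ (Fin (n + 1) → ℂ)) :
    lineSet V ⊆ X ↔ ∀ w ∈ V, ∀ i, MvPolynomial.eval w (f i) = 0 := by
  constructor
  · intro h w hw i
    by_cases h0 : w = 0
    · have h1 := aux_eval_smul (hX.homog i) 0 w
      rw [zero_smul, zero_pow (by have := hX.two_le_deg i; omega), zero_mul] at h1
      rw [h0, h1]
    · obtain ⟨a, ha⟩ := Projectivization.exists_smul_eq_mk_rep ℂ w h0
      have h1 : Projectivization.mk ℂ w h0 ∈ lineSet V := by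
        change (Projectivization.mk ℂ w h0).rep ∈ V
        rw [← ha]
        exact V.smul_mem _ hw
      have h2 := h h1
      rw [hX.locus] at h2
      have h3 := h2 i
      rw [← ha, Units.smul_def, aux_eval_smul (hX.homog i)] at h3
      exact (mul_eq_zero.1 h3).resolve_left (pow_ne_zero _ a.ne_zero)
  · intro h x hx
    rw [hX.locus]
    exact fun i => h _ hx i

def auxMap {D n : ℕ} (ι : (Fin (D + 1) → ℂ) →ₗ[ℂ] (Fin (n + 1) → ℂ)) (hι : Function.Injective ι)
    (V : ProjLine D) : ProjLine n :=
  ⟨V.1.map ι, (Submodule.equivMapOfInjective ι hι V.1).finrank_eq.symm.trans V.2⟩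

lemma auxMap_inducing {D n : ℕ} (ι : (Fin (D + 1) → ℂ) →ₗ[ℂ] (Fin (n + 1) → ℂ))
    (hι : Function.Injective ι) : Topology.IsInducing (auxMap ι hι) := by
  obtain ⟨π, hπ⟩ := ι.exists_leftInverse_of_injective (LinearMap.ker_eq_bot.2 hι)
  have hπ' : ∀ x, π (ι x) = x := fun x => LinearMap.congr_fun hπ x
  constructor
  apply le_antisymm
  · rw [← continuous_iff_le_induced]
    refine continuous_generateFrom_iff.2 ?_
    rintro _ ⟨F, rfl⟩
    obtain ⟨P, hP⟩ : auxPF (fun z : auxI D → ℂ =>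
        MvPolynomial.eval (Sum.elim (ι (auxL z)) (ι (auxR z))) F) := by
      apply auxPF.comp
      rintro (i | i)
      · exact auxPF.lin ((LinearMap.proj i).comp ι) auxL_pf
      · exact auxPF.lin ((LinearMap.proj i).comp ι) auxR_pf
    apply TopologicalSpace.isOpen_generateFrom_of_mem
    refine ⟨P, ?_⟩
    ext V
    simp only [Set.mem_preimage, Set.mem_ofPred_eq, hP, auxL_elim, auxR_elim]
    refine not_congr ?_
    simp only [auxMap]
    constructor
    · intro h u hu v hv
      exact h _ (Submodule.mem_map_of_mem hu) _ (Submodule.mem_map_of_mem hv)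
    · rintro h _ ⟨u, hu, rfl⟩ _ ⟨v, hv, rfl⟩
      exact h u hu v hv
  · conv_rhs => rw [grassZariski]
    apply le_generateFrom
    rintro _ ⟨F, rfl⟩
    obtain ⟨P, hP⟩ : auxPF (fun z : auxI n → ℂ =>
        MvPolynomial.eval (Sum.elim (π (auxL z)) (π (auxR z))) F) := by
      apply auxPF.comp
      rintro (i | i)
      · exact auxPF.lin ((LinearMap.proj i).comp π) auxL_pf
      · exact auxPF.lin ((LinearMap.proj i).comp π) auxR_pf
    refine isOpen_induced_iff.2 ⟨_, TopologicalSpace.isOpen_generateFrom_of_mem ⟨P, rfl⟩, ?_⟩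
    ext V
    simp only [Set.mem_preimage, Set.mem_ofPred_eq, hP, auxL_elim, auxR_elim]
    refine not_congr ?_
    simp only [auxMap]
    constructor
    · intro h u hu v hv
      have := h _ (Submodule.mem_map_of_mem hu) _ (Submodule.mem_map_of_mem hv)
      rwa [hπ', hπ'] at this
    · rintro h _ ⟨u, hu, rfl⟩ _ ⟨v, hv, rfl⟩
      rw [hπ', hπ']
      exact h u hu v hv

lemma aux_section_iff {D n : ℕ} (ι : (Fin (D + 1) → ℂ) →ₗ[ℂ] (Fin (n + 1) → ℂ))
    (hι : Function.Injective ι) (X : Set (Projectivization ℂ (Fin (n + 1) → ℂ)))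
    (Y : Set (Projectivization ℂ (Fin (D + 1) → ℂ)))
    (hYX : Projectivization.map ι hι '' Y = {x | x.rep ∈ LinearMap.range ι} ∩ X)
    (V : Submodule ℂ (Fin (D + 1) → ℂ)) :
    lineSet V ⊆ Y ↔ lineSet (V.map ι) ⊆ X := by
  constructor
  · intro h x hx
    obtain ⟨v, hv, hvx⟩ := hx
    have hv0 : v ≠ 0 := by
      rintro rfl
      exact x.rep_nonzero (by rw [← hvx, map_zero])
    obtain ⟨a, ha⟩ := Projectivization.exists_smul_eq_mk_rep ℂ v hv0
    have h1 : Projectivization.mk ℂ v hv0 ∈ Y := by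
      apply h
      change (Projectivization.mk ℂ v hv0).rep ∈ V
      rw [← ha]
      exact V.smul_mem _ hv
    have h2 : x = Projectivization.map ι hι (Projectivization.mk ℂ v hv0) := by
      rw [Projectivization.map_mk]
      conv_lhs => rw [← x.mk_rep]
      congr 1
      exact hvx.symm
    have h3 : x ∈ Projectivization.map ι hι '' Y := ⟨_, h1, h2.symm⟩
    rw [hYX] at h3
    exact h3.2
  · intro h y hy
    have hy' : ι y.rep ≠ 0 := fun h0 => y.rep_nonzero (hι (by rw [h0, map_zero]))
    have h2 : Projectivization.map ι hι y = Projectivization.mk ℂ (ι y.rep) hy' := by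
      conv_lhs => rw [← y.mk_rep]
      rw [Projectivization.map_mk]
    obtain ⟨a, ha⟩ := Projectivization.exists_smul_eq_mk_rep ℂ (ι y.rep) hy'
    have h4 : (Projectivization.map ι hι y).rep ∈ V.map ι := by
      rw [h2, ← ha]
      exact Submodule.smul_mem _ _ (Submodule.mem_map_of_mem hy)
    have h3 : Projectivization.map ι hι y ∈ Projectivization.map ι hι '' Y := by
      rw [hYX]
      refine ⟨?_, h h4⟩
      obtain ⟨v, _, hv⟩ := h4
      exact ⟨v, hv⟩
    obtain ⟨y', hy', he⟩ := h3
    rwa [← Projectivization.map_injective ι hι he]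

lemma aux_functionals {n : ℕ} (W : ProjLine n) :
    ∃ q1 q2 : (Fin (n + 1) → ℂ) →ₗ[ℂ] ℂ, W ∈ auxU0 q1 q2 := by
  let b := Module.finBasisOfFinrankEq ℂ W.1 W.2
  obtain ⟨q1, h1⟩ := LinearMap.exists_extend (b.coord 0)
  obtain ⟨q2, h2⟩ := LinearMap.exists_extend (b.coord 1)
  have h1' : ∀ x : W.1, q1 x = b.coord 0 x := fun x => LinearMap.congr_fun h1 x
  have h2' : ∀ x : W.1, q2 x = b.coord 1 x := fun x => LinearMap.congr_fun h2 x
  refine ⟨q1, q2, b 0, (b 0).2, b 1, (b 1).2, ?_⟩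
  rw [h1', h1', h2', h2']
  simp

lemma aux_equations {D n : ℕ} (ι : (Fin (D + 1) → ℂ) →ₗ[ℂ] (Fin (n + 1) → ℂ))
    (hι : Function.Injective ι) :
    ∃ ℓ : Fin (n - D) → ((Fin (n + 1) → ℂ) →ₗ[ℂ] ℂ),
      ∀ x, x ∈ LinearMap.range ι ↔ ∀ k, ℓ k x = 0 := by
  have h1 : Module.finrank ℂ ((Fin (n + 1) → ℂ) ⧸ LinearMap.range ι) = n - D := by
    have := Submodule.finrank_quotient_add_finrank (LinearMap.range ι)
    rw [LinearMap.finrank_range_of_inj hι] at this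
    simp at this
    omega
  let b := Module.finBasisOfFinrankEq ℂ _ h1
  refine ⟨fun k => (b.coord k).comp (LinearMap.range ι).mkQ, fun x => ?_⟩
  rw [← Submodule.Quotient.mk_eq_zero, ← b.forall_coord_eq_zero_iff]
  rfl

lemma aux_deg_one {n : ℕ} {p : MvPolynomial (Fin (n + 1)) ℂ} (hp : p.IsHomogeneous 1) :
    ∃ A : (Fin (n + 1) → ℂ) →ₗ[ℂ] ℂ, ∀ v, A v = MvPolynomial.eval v p := by
  rw [← MvPolynomial.mem_homogeneousSubmodule, MvPolynomial.homogeneousSubmodule_one_eq_span_X] at hp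
  induction hp using Submodule.span_induction with
  | mem x h =>
    obtain ⟨i, rfl⟩ := h
    exact ⟨LinearMap.proj i, fun v => by simp⟩
  | zero => exact ⟨0, fun v => by simp⟩
  | add x y _ _ hx hy =>
    obtain ⟨A, hA⟩ := hx
    obtain ⟨B, hB⟩ := hy
    exact ⟨A + B, fun v => by simp [hA, hB]⟩
  | smul a x _ hx =>
    obtain ⟨A, hA⟩ := hx
    exact ⟨a • A, fun v => by simp [hA, MvPolynomial.smul_eval]⟩

lemma aux_deriv {n : ℕ} (f : MvPolynomial (Fin n) ℂ) (w v : Fin n → ℂ) :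
    HasDerivAt (fun t : ℂ => MvPolynomial.eval (w + t • v) f)
      (∑ j, v j * MvPolynomial.eval w (MvPolynomial.pderiv j f)) 0 := by
  induction f using MvPolynomial.induction_on with
  | C c => simpa using hasDerivAt_const (0 : ℂ) c
  | add p q hp hq =>
    have hfun : (fun t : ℂ => MvPolynomial.eval (w + t • v) (p + q)) =
        (fun t : ℂ => MvPolynomial.eval (w + t • v) p) +
          fun t : ℂ => MvPolynomial.eval (w + t • v) q := by
      ext t; simp
    rw [hfun]
    refine (hp.add hq).congr_deriv ?_
    simp [mul_add, Finset.sum_add_distrib]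
  | mul_X p i hp =>
    have h1 : HasDerivAt (fun t : ℂ => w i + t * v i) (v i) 0 := by
      simpa using ((hasDerivAt_id (0 : ℂ)).mul_const (v i)).const_add (w i)
    have h2 := hp.mul h1
    have hfun : (fun t : ℂ => MvPolynomial.eval (w + t • v) (p * MvPolynomial.X i)) =
        (fun t : ℂ => MvPolynomial.eval (w + t • v) p) * fun t : ℂ => w i + t * v i := by
      ext t; simp
    rw [hfun]
    refine h2.congr_deriv (Eq.symm ?_)
    · simp only [Derivation.leibniz, MvPolynomial.pderiv_X, smul_eq_mul, map_add, map_mul,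
        MvPolynomial.eval_X, zero_smul, add_zero, zero_mul, mul_add, Finset.sum_add_distrib]
      rw [add_comm, Finset.sum_mul]
      congr 1
      · exact Finset.sum_congr rfl fun j _ => by ring
      · rw [Finset.sum_eq_single i]
        · simp; ring
        · intro j _ hj
          simp [Pi.single_apply, hj]
        · simp

lemma aux_conic (f : MvPolynomial (Fin (2 + 1)) ℂ) (hf : f.IsHomogeneous 2)
    (V : Submodule ℂ (Fin (2 + 1) → ℂ)) (hV : Module.finrank ℂ V = 2)
    (h : ∀ w ∈ V, MvPolynomial.eval w f = 0) :
    ∃ w ∈ V, w ≠ 0 ∧ ∀ j, MvPolynomial.eval w (MvPolynomial.pderiv j f) = 0 := by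
  have hne : ∃ e, e ∉ V := by
    by_contra hcon
    push Not at hcon
    have : V = ⊤ := eq_top_iff.2 fun x _ => hcon x
    rw [this, finrank_top] at hV
    simp at hV
  obtain ⟨e, he⟩ := hne
  have hA : ∀ j : Fin (2 + 1), ∃ A : (Fin (2 + 1) → ℂ) →ₗ[ℂ] ℂ,
      ∀ v, A v = MvPolynomial.eval v (MvPolynomial.pderiv j f) :=
    fun j => aux_deg_one hf.pderiv
  choose A hA using hA
  let E : V →ₗ[ℂ] ℂ := (∑ j, e j • A j).comp V.subtype
  have hk : LinearMap.ker E ≠ ⊥ := LinearMap.ker_ne_bot_of_finrank_lt (by rw [hV]; simp)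
  obtain ⟨w, hw, hw0⟩ := Submodule.exists_mem_ne_zero_of_ne_bot hk
  refine ⟨w, w.2, fun h0 => hw0 (Subtype.ext h0), ?_⟩
  let G : (Fin (2 + 1) → ℂ) →ₗ[ℂ] ℂ :=
    ∑ j, (MvPolynomial.eval (w : Fin (2 + 1) → ℂ) (MvPolynomial.pderiv j f)) • LinearMap.proj j
  have hG : ∀ v, G v = ∑ j, v j * MvPolynomial.eval (w : Fin (2 + 1) → ℂ) (MvPolynomial.pderiv j f) := by
    intro v
    simp only [G, LinearMap.sum_apply, LinearMap.smul_apply, LinearMap.proj_apply, smul_eq_mul]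
    exact Finset.sum_congr rfl fun j _ => mul_comm _ _
  have h1 : V ≤ LinearMap.ker G := by
    intro v hv
    rw [LinearMap.mem_ker, hG]
    have h2 := aux_deriv f w v
    have h3 : (fun t : ℂ => MvPolynomial.eval ((w : Fin (2 + 1) → ℂ) + t • v) f) = fun _ => 0 := by
      ext t
      exact h _ (V.add_mem w.2 (V.smul_mem t hv))
    rw [h3] at h2
    exact h2.unique (hasDerivAt_const _ _)
  have h2 : e ∈ LinearMap.ker G := by
    rw [LinearMap.mem_ker, hG]
    have : E w = 0 := hw
    simpa [E, hA] using this
  have h3 : V < LinearMap.ker G := lt_of_le_of_ne h1 fun h' => he (h' ▸ h2)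
  have h4 := Submodule.finrank_lt_finrank_of_lt h3
  have h5 : LinearMap.ker G = ⊤ := by
    apply Submodule.eq_top_of_finrank_eq
    have h6 := Submodule.finrank_le (LinearMap.ker G)
    have h7 : Module.finrank ℂ (Fin (2 + 1) → ℂ) = 3 := by simp
    rw [h7] at h6 ⊢
    rw [hV] at h4
    exact le_antisymm h6 h4
  intro j
  have h6 : G (Pi.single j 1) = 0 := by
    have : Pi.single j 1 ∈ LinearMap.ker G := by rw [h5]; trivial
    exact this
  rw [hG, Finset.sum_eq_single j] at h6
  · simpa using h6
  · intro i _ hi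
    simp [Pi.single_apply, hi]
  · simp

lemma aux_numeric {D s : ℕ} {d : Fin s → ℕ} (hD : D = ∑ i, d i)
    {g : Fin s → MvPolynomial (Fin (D + 1)) ℂ} {Y : Set (Projectivization ℂ (Fin (D + 1) → ℂ))}
    (hY : IsSmoothCI D s d g Y) (V : Submodule ℂ (Fin (D + 1) → ℂ))
    (hV : Module.finrank ℂ V = 2) (hVY : lineSet V ⊆ Y) : s + 2 ≤ D := by
  have h1 : 2 * s ≤ D := by
    have h2 := Finset.card_nsmul_le_sum Finset.univ d 2 (fun i _ => hY.two_le_deg i)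
    rw [← hD, Finset.card_univ, Fintype.card_fin, smul_eq_mul] at h2
    omega
  have hvan := (aux_fano_iff hY V).1 hVY
  by_contra hcon
  have hs : s < 2 := by omega
  interval_cases s
  · have hD0 : D = 0 := by simpa using hD
    have := Submodule.finrank_le V
    rw [hV] at this
    simp [hD0] at this
  · have hD2 : D = 2 := by omega
    subst hD2
    have hd : d 0 = 2 := by simpa using hD.symm
    have hh := hY.homog 0
    rw [hd] at hh
    obtain ⟨w, hw, hw0, hgr⟩ := aux_conic (g 0) hh V hV (fun w hw => hvan w hw 0)
    have h2 := hY.smooth w hw0 (hvan w hw)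
    have h3 : (Matrix.of fun (i : Fin 1) j => MvPolynomial.eval w (MvPolynomial.pderiv j (g i))) = 0 := by
      ext i j
      fin_cases i
      simpa using hgr j
    rw [h3, Matrix.rank_zero] at h2
    omega

def auxG {n s : ℕ} (q1 q2 : (Fin (n + 1) → ℂ) →ₗ[ℂ] ℂ)
    (f : Fin s → MvPolynomial (Fin (n + 1)) ℂ) : Set (auxI n → ℂ) :=
  {z | auxNrm q1 q2 z ∧ ∀ (a b : ℂ) (i : Fin s), MvPolynomial.eval (a • auxL z + b • auxR z) (f i) = 0}

def auxJ {n s : ℕ} (q1 q2 : (Fin (n + 1) → ℂ) →ₗ[ℂ] ℂ)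
    (f : Fin s → MvPolynomial (Fin (n + 1)) ℂ) : Ideal (MvPolynomial (auxI n) ℂ) :=
  Ideal.span {P | ∀ z ∈ auxG q1 q2 f, MvPolynomial.eval z P = 0}

lemma auxJ_iff {n s : ℕ} (q1 q2 : (Fin (n + 1) → ℂ) →ₗ[ℂ] ℂ)
    (f : Fin s → MvPolynomial (Fin (n + 1)) ℂ) (z : auxI n → ℂ) :
    (∀ P ∈ auxJ q1 q2 f, MvPolynomial.eval z P = 0) ↔ z ∈ auxG q1 q2 f := by
  constructor
  · intro h
    have key : ∀ F : (auxI n → ℂ) → ℂ, auxPF F → (∀ y ∈ auxG q1 q2 f, F y = 0) → F z = 0 := by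
      rintro F ⟨P, hP⟩ hF
      rw [← hP]
      exact h P (Ideal.subset_span fun y hy => by rw [hP]; exact hF y hy)
    refine ⟨⟨?_, ?_, ?_, ?_⟩, ?_⟩
    · exact sub_eq_zero.1 (key (fun z => q1 (auxL z) - 1) ((auxPF.lin q1 auxL_pf).sub (auxPF.const 1))
        (fun y hy => sub_eq_zero.2 hy.1.a))
    · exact key (fun z => q2 (auxL z)) (auxPF.lin q2 auxL_pf) (fun y hy => hy.1.b)
    · exact key (fun z => q1 (auxR z)) (auxPF.lin q1 auxR_pf) (fun y hy => hy.1.c)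
    · exact sub_eq_zero.1 (key (fun z => q2 (auxR z) - 1) ((auxPF.lin q2 auxR_pf).sub (auxPF.const 1))
        (fun y hy => sub_eq_zero.2 hy.1.d))
    · intro a b i
      refine key (fun z => MvPolynomial.eval (a • auxL z + b • auxR z) (f i)) (auxPF.comp _ fun j => ?_)
        (fun y hy => hy.2 a b i)
      exact ((auxPF.const _).mul (auxL_pf j)).add ((auxPF.const _).mul (auxR_pf j))
  · intro hz P hP
    have : auxJ q1 q2 f ≤ RingHom.ker (MvPolynomial.eval z) :=
      Ideal.span_le.2 fun Q hQ => hQ z hz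
    exact this hP

lemma auxG_iff {n s : ℕ} {q1 q2 : (Fin (n + 1) → ℂ) →ₗ[ℂ] ℂ} {d : Fin s → ℕ}
    {f : Fin s → MvPolynomial (Fin (n + 1)) ℂ}
    {X : Set (Projectivization ℂ (Fin (n + 1) → ℂ))} (hX : IsSmoothCI n s d f X)
    {V : ProjLine n} {z : auxI n → ℂ} (h : auxFr q1 q2 V z) :
    V ∈ fanoLines X ↔ z ∈ auxG q1 q2 f := by
  change lineSet V.1 ⊆ X ↔ _
  rw [aux_fano_iff hX]
  constructor
  · intro h1
    exact ⟨h.nrm, fun a b i => h1 _ (add_mem (Submodule.smul_mem _ _ h.memL)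
      (Submodule.smul_mem _ _ h.memR)) i⟩
  · intro h1 w hw i
    rw [h.spn w hw]
    exact h1.2 _ _ i

lemma aux_main (n D s : ℕ) (d : Fin s → ℕ)
    (f : Fin s → MvPolynomial (Fin (n + 1)) ℂ)
    (X : Set (Projectivization ℂ (Fin (n + 1) → ℂ)))
    (hX : IsSmoothCI n s d f X)
    (ι : (Fin (D + 1) → ℂ) →ₗ[ℂ] (Fin (n + 1) → ℂ)) (hι : Function.Injective ι)
    (Y : Set (Projectivization ℂ (Fin (D + 1) → ℂ)))
    (hYX : Projectivization.map ι hι '' Y = {x | x.rep ∈ LinearMap.range ι} ∩ X)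
    (W' : ProjLine D) (hl : auxMap ι hι W' ∈ fanoLines X) :
    localTKDim (fanoLines X) (auxMap ι hι W') ≤
      localTKDim (fanoLines Y) W' + ((2 * (n - D) : ℕ) : WithBot ℕ∞) := by
  classical
  obtain ⟨q1, q2, hW0⟩ := aux_functionals (auxMap ι hι W')
  obtain ⟨ℓ, hℓ⟩ := aux_equations ι hι
  have hch : ∀ V : ProjLine n, ∃ z, V ∈ auxU0 q1 q2 → auxFr q1 q2 V z := by
    intro V
    by_cases h : V ∈ auxU0 q1 q2
    · obtain ⟨z, hz⟩ := auxFr_exists h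
      exact ⟨z, fun _ => hz⟩
    · exact ⟨0, fun h' => absurd h' h⟩
  choose φ hφ using hch
  have hLex : ∀ k : Fin (n - D) × Bool, ∃ P : MvPolynomial (auxI n) ℂ,
      ∀ z, MvPolynomial.eval z P = if k.2 then ℓ k.1 (auxL z) else ℓ k.1 (auxR z) := by
    rintro ⟨k, b⟩
    cases b
    · exact auxPF.lin (ℓ k) auxR_pf
    · exact auxPF.lin (ℓ k) auxL_pf
  choose L hL using hLex
  have hLiff : ∀ z, (∀ k, MvPolynomial.eval z (L k) = 0) ↔
      auxL z ∈ LinearMap.range ι ∧ auxR z ∈ LinearMap.range ι := by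
    intro z
    rw [hℓ, hℓ]
    constructor
    · intro h
      exact ⟨fun k => by simpa [hL] using h (k, true), fun k => by simpa [hL] using h (k, false)⟩
    · rintro ⟨h1, h2⟩ ⟨k, b⟩
      cases b
      · simpa [hL] using h2 k
      · simpa [hL] using h1 k
  have hrange : ∀ V : ProjLine D, ∀ x ∈ (auxMap ι hι V).1, x ∈ LinearMap.range ι := by
    rintro V _ ⟨v, _, rfl⟩
    exact ⟨v, rfl⟩
  have hFW := hφ _ hW0
  obtain ⟨g, h, h', hg, hhh, hup, hlow⟩ := aux_core (auxJ q1 q2 f) (φ (auxMap ι hι W'))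
    ((auxJ_iff q1 q2 f _).2 ((auxG_iff hX hFW).1 hl)) L
    ((hLiff _).2 ⟨hrange _ _ hFW.memL, hrange _ _ hFW.memR⟩)
  -- the upper bound for the big Fano variety
  have hXle : localTKDim (fanoLines X) (auxMap ι hι W') ≤ (h : WithBot ℕ∞) := by
    obtain ⟨F, hF⟩ := aux_pull q1 q2 g
    let U : Set (ProjLine n) := auxU0 q1 q2 ∩
      {W : ProjLine n | ¬ ∀ u ∈ W.1, ∀ v ∈ W.1, MvPolynomial.eval (Sum.elim u v) F = 0}
    have hUo : IsOpen U := (auxU0_open q1 q2).inter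
      (TopologicalSpace.isOpen_generateFrom_of_mem ⟨F, rfl⟩)
    have hU : ∀ V ∈ U, MvPolynomial.eval (φ V) g ≠ 0 := fun V hV h0 =>
      hV.2 ((hF V _ (hφ V hV.1)).2 h0)
    have hWU : auxMap ι hι W' ∈ U := ⟨hW0, fun h0 => hg ((hF _ _ hFW).1 h0)⟩
    have hle : localTKDim (fanoLines X) (auxMap ι hι W') ≤
        topologicalKrullDim ↥(fanoLines X ∩ U) := by
      unfold localTKDim
      exact iInf_le_of_le U (iInf_le_of_le hUo (iInf_le _ hWU))
    refine hle.trans ?_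
    refine hup ↥(fanoLines X ∩ U) (fun t => φ t.1) ?_ ?_ ?_
    · exact aux_chart_inducing q1 q2 (fun t : ↥(fanoLines X ∩ U) => t.1)
        Topology.IsInducing.subtypeVal _ (fun t => hφ _ t.2.2.1)
    · intro t
      exact (auxJ_iff q1 q2 f _).2 ((auxG_iff hX (hφ _ t.2.2.1)).1 t.2.1)
    · exact fun t => hU _ t.2.2
  -- the lower bound for the small Fano variety
  have hYge : (h' : WithBot ℕ∞) ≤ localTKDim (fanoLines Y) W' := by
    refine le_iInf fun U => le_iInf fun hU => le_iInf fun hWU => ?_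
    let T0 := {V : ProjLine D // auxMap ι hι V ∈ auxU0 q1 q2}
    let φ0 : T0 → auxI n → ℂ := fun t => φ (auxMap ι hι t.1)
    have hφ0 : ∀ t : T0, auxFr q1 q2 (auxMap ι hι t.1) (φ0 t) := fun t => hφ _ t.2
    have hind0 := aux_chart_inducing q1 q2 (fun t : T0 => auxMap ι hι t.1)
      ((auxMap_inducing ι hι).comp Topology.IsInducing.subtypeVal) φ0 hφ0
    have hUo : IsOpen {t : T0 | t.1 ∈ U} := hU.preimage continuous_subtype_val
    obtain ⟨O, hO, hOU⟩ := hind0.isOpen_iff.1 hUo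
    have hOU' : ∀ t : T0, MvPolynomial.pointToPoint (φ0 t) ∈ O ↔ t.1 ∈ U := fun t =>
      Set.ext_iff.1 hOU t
    let T := {t : T0 // t.1 ∈ fanoLines Y ∩ U}
    have hT1 : Topology.IsInducing (fun t : T => t.1.1) :=
      Topology.IsInducing.subtypeVal.comp Topology.IsInducing.subtypeVal
    have hT2 : Topology.IsInducing (fun t : T => (⟨t.1.1, t.2⟩ : ↥(fanoLines Y ∩ U))) := by
      apply Topology.IsInducing.of_comp_iff (Topology.IsInducing.subtypeVal) |>.1
      exact hT1
    refine le_trans ?_ hT2.topologicalKrullDim_le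
    refine hlow T (fun t => φ0 t.1) O hO ((hOU' ⟨W', hW0⟩).2 hWU)
      (hind0.comp Topology.IsInducing.subtypeVal) ?_
    intro x hxO hxJ hxL
    have hxG := (auxJ_iff q1 q2 f _).1 hxJ
    obtain ⟨⟨u, hu⟩, ⟨v, hv⟩⟩ := (hLiff x).1 hxL
    have hfr : Module.finrank ℂ (Submodule.span ℂ (Set.range ![u, v])) = 2 := by
      have hli : LinearIndependent ℂ ![u, v] := by
        rw [LinearIndependent.pair_iff]
        intro a b hab
        have h1 : a • auxL x + b • auxR x = 0 := by
          rw [← hu, ← hv, ← map_smul, ← map_smul, ← map_add, hab, map_zero]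
        have h2 := congrArg q1 h1
        have h3 := congrArg q2 h1
        simp [hxG.1.a, hxG.1.b, hxG.1.c, hxG.1.d] at h2 h3
        exact ⟨h2, h3⟩
      simpa using finrank_span_eq_card hli
    let V : ProjLine D := ⟨Submodule.span ℂ (Set.range ![u, v]), hfr⟩
    have huV : auxL x ∈ (auxMap ι hι V).1 := ⟨u, Submodule.subset_span ⟨0, rfl⟩, hu⟩
    have hvV : auxR x ∈ (auxMap ι hι V).1 := ⟨v, Submodule.subset_span ⟨1, rfl⟩, hv⟩
    have hVU0 := auxU0_of_nrm hxG.1 huV hvV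
    have hVF := auxFr_of_nrm hxG.1 huV hvV
    have hex : φ0 ⟨V, hVU0⟩ = x := (hφ0 ⟨V, hVU0⟩).unique hVF
    have hVX := (auxG_iff hX hVF).2 hxG
    have hVY : V ∈ fanoLines Y := (aux_section_iff ι hι X Y hYX V.1).2 hVX
    have hVU : V ∈ U := (hOU' ⟨V, hVU0⟩).1 (by rw [hex]; exact hxO)
    exact ⟨⟨⟨V, hVU0⟩, hVY, hVU⟩, hex⟩
  have hcard : (Fintype.card (Fin (n - D) × Bool) : ℕ∞) = ((2 * (n - D) : ℕ) : ℕ∞) := by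
    simp [mul_comm]
  rw [hcard] at hhh
  refine hXle.trans ((WithBot.coe_le_coe.2 hhh).trans ?_)
  rw [WithBot.coe_add]
  exact add_le_add_left hYge _

/-- **Lemma.**  Let `X ⊆ ℙ^n` be a smooth complete intersection of type `(d_1, …, d_s)`,
`D := Σ d_i ≤ n`, let `l = ℙ(W) ⊆ X` be a line, and let `Λ = ℙ(range ι) ≅ ℙ^D` be a linear
subspace of `ℙ^n` containing `l` (here `ι : ℂ^{D+1} ↪ ℂ^{n+1}` is an injective linear
parametrization of `Λ`, and `W = ι(W′)`), such that `Y := Λ ∩ X` — identified via `ι` with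
the subvariety `Y ⊆ ℙ^D` — is a smooth complete intersection of type `(d_1, …, d_s)` in
`Λ ≅ ℙ^D`.  Then `dim_[l] F(X) ≤ dim_[l] F(Y) + 2(n − D)`; in particular, if
`dim_[l] F(Y) = D − s − 2`, then `dim_[l] F(X) ≤ 2n − D − s − 2`. -/
theorem localDim_fanoLines_le_of_linear_section
    (n D s : ℕ) (d : Fin s → ℕ) (hD : D = ∑ i, d i) (hDn : D ≤ n)
    (f : Fin s → MvPolynomial (Fin (n + 1)) ℂ)
    (X : Set (Projectivization ℂ (Fin (n + 1) → ℂ)))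
    (hX : IsSmoothCI n s d f X)
    (W : Submodule ℂ (Fin (n + 1) → ℂ)) (hW : Module.finrank ℂ W = 2)
    (hlX : lineSet W ⊆ X)
    (ι : (Fin (D + 1) → ℂ) →ₗ[ℂ] (Fin (n + 1) → ℂ)) (hι : Function.Injective ι)
    (hWι : W ≤ LinearMap.range ι)
    (g : Fin s → MvPolynomial (Fin (D + 1)) ℂ)
    (Y : Set (Projectivization ℂ (Fin (D + 1) → ℂ)))
    (hY : IsSmoothCI D s d g Y)
    (hYX : Projectivization.map ι hι '' Y = {x | x.rep ∈ LinearMap.range ι} ∩ X)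
    (W' : Submodule ℂ (Fin (D + 1) → ℂ)) (hW' : Module.finrank ℂ W' = 2)
    (hWW : W'.map ι = W) :
    localTKDim (fanoLines X) ⟨W, hW⟩ ≤
      localTKDim (fanoLines Y) ⟨W', hW'⟩ + ((2 * (n - D) : ℕ) : WithBot ℕ∞) ∧
    (localTKDim (fanoLines Y) ⟨W', hW'⟩ = ((D - s - 2 : ℕ) : WithBot ℕ∞) →
      localTKDim (fanoLines X) ⟨W, hW⟩ ≤ ((2 * n - D - s - 2 : ℕ) : WithBot ℕ∞)) := by
  subst hWW
  have hl : auxMap ι hι ⟨W', hW'⟩ ∈ fanoLines X := hlX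
  have h1 := aux_main n D s d f X hX ι hι Y hYX ⟨W', hW'⟩ hl
  refine ⟨h1, fun h2 => ?_⟩
  have hWY : lineSet W' ⊆ Y := (aux_section_iff ι hι X Y hYX W').2 hlX
  have h3 := aux_numeric hD hY W' hW' hWY
  refine h1.trans ?_
  rw [h2, ← Nat.cast_add]
  exact_mod_cast (show D - s - 2 + 2 * (n - D) ≤ 2 * n - D - s - 2 by omega)

end
end
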